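/- arXiv:2401.04676 — 2 statements merged into one kernel-verified Lean document; each statement's English description precedes it below -/
import Mathlib

section
/- Rank-stability is preserved by direct products: let F be a field, let P_1,…,P_r ∈ F⟨x_1,…,x_d⟩ and Q_1,…,Q_s ∈ F⟨y_1,…,y_t⟩ be noncommutative polynomials, and suppose each of the two systems admits an exact solution in M_n(F) for some n ≥ 1 (i.e., each presented algebra has a finite-dimensional representation). Consider the presentation of the direct product of the two algebras with generators x_1,…,x_d, y_1,…,y_t, e_1, e_2 and relations e_1P_j (1 ≤ j ≤ r), e_2Q_j (1 ≤ j ≤ s), e_1x_i − x_i, x_ie_1 − x_i (1 ≤ i ≤ d), e_2y_i − y_i, y_ie_2 − y_i (1 ≤ i ≤ t), e_1 + e_2 − 1, e_1² − e_1, e_2² − e_2. This presentation is rank-stable if and only if both presentations F⟨x_1,…,x_d⟩/⟨P_1,…,P_r⟩ and F⟨y_1,…,y_t⟩/⟨Q_1,…,Q_s⟩ are rank-stable. -/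
open Matrix

noncomputable section

/-- Zero-padding of a square matrix to size `m` (the ℕ×ℕ extension `Â`, clipped to size `m`). -/
def padTo {F : Type} [Zero F] {n : ℕ} (m : ℕ) (A : Matrix (Fin n) (Fin n) F) :
    Matrix (Fin m) (Fin m) F :=
  Matrix.of fun i j =>
    if h : (i : ℕ) < n ∧ (j : ℕ) < n then A ⟨i, h.1⟩ ⟨j, h.2⟩ else 0

/-- `Rank(Â − B̂)` for `A ∈ M_n(F)` and `B ∈ M_{n'}(F)`. -/
def padRankDiff {F : Type} [Field F] {n n' : ℕ} (A : Matrix (Fin n) (Fin n) F)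
    (B : Matrix (Fin n') (Fin n') F) : ℕ :=
  (padTo (max n n') A - padTo (max n n') B).rank

/-- Evaluation of a noncommutative polynomial `P ∈ F⟨x_s : s ∈ σ⟩` at a tuple of matrices,
where scalar terms are interpreted as scalar matrices. -/
def evalPoly {F : Type} [Field F] {σ : Type} {n : ℕ}
    (P : FreeAlgebra F σ) (A : σ → Matrix (Fin n) (Fin n) F) :
    Matrix (Fin n) (Fin n) F :=
  FreeAlgebra.lift F A P

/-- Rank-stability of the presentation `F⟨x_s : s ∈ σ⟩ / ⟨P_i : i ∈ ι⟩`. -/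
def RankStable (F : Type) [Field F] {σ ι : Type} (P : ι → FreeAlgebra F σ) : Prop :=
  ∀ ε : ℝ, 0 < ε → ∃ δ : ℝ, 0 < δ ∧
    ∀ n : ℕ, 0 < n → ∀ A : σ → Matrix (Fin n) (Fin n) F,
      (∀ i, ((evalPoly (P i) A).rank : ℝ) < δ * n) →
      ∃ n' : ℕ, 0 < n' ∧ ∃ B : σ → Matrix (Fin n') (Fin n') F,
        (∀ i, evalPoly (P i) B = 0) ∧
        ∀ j, ((padRankDiff (A j) (B j) : ℝ) < ε * n)

/-- The relations of the presentation of the direct product `A × A'` of the algebras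
presented by `P` (generators `x_i`) and `Q` (generators `y_i`), with two extra generators
`e₁, e₂` (the two central idempotents): the relations are `e₁P_j`, `e₂Q_j`,
`e₁x_i − x_i`, `x_ie₁ − x_i`, `e₂y_i − y_i`, `y_ie₂ − y_i`, `e₁ + e₂ − 1`, `e₁² − e₁`,
`e₂² − e₂`. -/
def directProductRels (F : Type) [Field F] {d t r s : ℕ}
    (P : Fin r → FreeAlgebra F (Fin d)) (Q : Fin s → FreeAlgebra F (Fin t)) :
    ((Fin r ⊕ Fin s) ⊕ (((Fin d ⊕ Fin d) ⊕ (Fin t ⊕ Fin t)) ⊕ Fin 3)) →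
      FreeAlgebra F ((Fin d ⊕ Fin t) ⊕ Fin 2) :=
  let x : Fin d → FreeAlgebra F ((Fin d ⊕ Fin t) ⊕ Fin 2) :=
    fun i => FreeAlgebra.ι F (Sum.inl (Sum.inl i))
  let y : Fin t → FreeAlgebra F ((Fin d ⊕ Fin t) ⊕ Fin 2) :=
    fun i => FreeAlgebra.ι F (Sum.inl (Sum.inr i))
  let e₁ : FreeAlgebra F ((Fin d ⊕ Fin t) ⊕ Fin 2) := FreeAlgebra.ι F (Sum.inr 0)
  let e₂ : FreeAlgebra F ((Fin d ⊕ Fin t) ⊕ Fin 2) := FreeAlgebra.ι F (Sum.inr 1)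
  Sum.elim
    (Sum.elim (fun j => e₁ * FreeAlgebra.lift F x (P j))
              (fun j => e₂ * FreeAlgebra.lift F y (Q j)))
    (Sum.elim
      (Sum.elim
        (Sum.elim (fun i => e₁ * x i - x i) (fun i => x i * e₁ - x i))
        (Sum.elim (fun i => e₂ * y i - y i) (fun i => y i * e₂ - y i)))
      (fun k => if k = 0 then e₁ + e₂ - 1 else if k = 1 then e₁ * e₁ - e₁ else e₂ * e₂ - e₂))

set_option linter.unusedSectionVars false

namespace LinearMap

section RealRank

variable {F U V W X : Type} [Field F]
  [AddCommGroup U] [Module F U] [FiniteDimensional F U]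
  [AddCommGroup V] [Module F V] [FiniteDimensional F V]
  [AddCommGroup W] [Module F W] [FiniteDimensional F W]
  [AddCommGroup X] [Module F X] [FiniteDimensional F X]

/-- The rank of a linear map, as a real number. -/
def realRank (g : V →ₗ[F] W) : ℝ := Module.finrank F (range g)

theorem realRank_nonneg (g : V →ₗ[F] W) : 0 ≤ g.realRank := Nat.cast_nonneg _

@[simp] theorem realRank_zero : (0 : V →ₗ[F] W).realRank = 0 := by
  rw [realRank, range_zero, finrank_bot, Nat.cast_zero]

@[simp] theorem realRank_neg (g : V →ₗ[F] W) : (-g).realRank = g.realRank := by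
  rw [realRank, range_neg, realRank]

theorem eq_zero_of_realRank_nonpos {g : V →ₗ[F] W} (h : g.realRank ≤ 0) : g = 0 := by
  have h' : Module.finrank F (range g) = 0 := by
    have := le_antisymm h g.realRank_nonneg
    unfold realRank at this
    exact_mod_cast this
  rwa [Submodule.finrank_eq_zero, range_eq_bot] at h'

theorem realRank_add_le (g h : V →ₗ[F] W) : (g + h).realRank ≤ g.realRank + h.realRank := by
  have hle : range (g + h) ≤ range g ⊔ range h := by
    rintro _ ⟨v, rfl⟩
    exact Submodule.add_mem_sup ⟨v, rfl⟩ ⟨v, rfl⟩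
  have := (Submodule.finrank_mono hle).trans (Submodule.finrank_add_le_finrank_add_finrank _ _)
  unfold realRank
  exact_mod_cast this

theorem realRank_sub_le (g h : V →ₗ[F] W) : (g - h).realRank ≤ g.realRank + h.realRank := by
  rw [sub_eq_add_neg, ← realRank_neg h]
  exact realRank_add_le _ _

theorem realRank_comp_le_left (g : V →ₗ[F] W) (h : U →ₗ[F] V) :
    (g ∘ₗ h).realRank ≤ g.realRank := by
  unfold realRank
  exact_mod_cast Submodule.finrank_mono (range_comp_le_range h g)

theorem realRank_comp_le_right (g : V →ₗ[F] W) (h : U →ₗ[F] V) :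
    (g ∘ₗ h).realRank ≤ h.realRank := by
  unfold realRank
  rw [range_comp]
  exact_mod_cast Submodule.finrank_map_le _ _

theorem realRank_le_finrank (g : V →ₗ[F] W) : g.realRank ≤ Module.finrank F V := by
  unfold realRank
  exact_mod_cast finrank_range_le g

theorem realRank_le_finrank_codomain (g : V →ₗ[F] W) : g.realRank ≤ Module.finrank F W := by
  unfold realRank
  exact_mod_cast Submodule.finrank_le _

theorem realRank_add_finrank_ker (g : V →ₗ[F] W) :
    g.realRank + Module.finrank F (ker g) = Module.finrank F V := by
  unfold realRank
  exact_mod_cast finrank_range_add_finrank_ker g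

theorem realRank_id : (id : V →ₗ[F] V).realRank = Module.finrank F V := by
  rw [realRank, range_id, finrank_top]

theorem realRank_le_of_le_ker {S : Submodule F V} {g : V →ₗ[F] W} (h : S ≤ ker g) :
    g.realRank ≤ Module.finrank F V - Module.finrank F S := by
  have h1 := g.realRank_add_finrank_ker
  have h2 : (Module.finrank F S : ℝ) ≤ Module.finrank F (ker g) := by
    exact_mod_cast Submodule.finrank_mono h
  linarith

theorem finrank_ker_comp_le (g : V →ₗ[F] W) (h : U →ₗ[F] V) :
    (Module.finrank F (ker (g ∘ₗ h)) : ℝ) ≤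
      Module.finrank F (ker g) + Module.finrank F (ker h) := by
  set r : ker (g ∘ₗ h) →ₗ[F] ker g := h.restrict (fun x hx => by simpa using hx) with hr
  have h1 := r.realRank_add_finrank_ker
  have h2 := r.realRank_le_finrank_codomain
  have h3 : Module.finrank F (ker r) ≤ Module.finrank F (ker h) := by
    let s : ker r →ₗ[F] ker h := ((ker (g ∘ₗ h)).subtype ∘ₗ (ker r).subtype).codRestrict (ker h)
      (fun x => by
        have := x.2
        rw [mem_ker] at this
        exact congrArg Subtype.val this)
    refine finrank_le_finrank_of_injective (f := s) ?_
    intro x y hxy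
    have := congrArg (fun z : ker h => (z : U)) hxy
    exact Subtype.ext (Subtype.ext this)
  have h3' : (Module.finrank F (ker r) : ℝ) ≤ Module.finrank F (ker h) := by exact_mod_cast h3
  linarith

/-- Injections of a space into two spaces of the same dimension differ by an isomorphism. -/
theorem exists_linearEquiv_comp_eq (i : U →ₗ[F] V) (j : U →ₗ[F] W)
    (hi : Function.Injective i) (hj : Function.Injective j)
    (hd : Module.finrank F V = Module.finrank F W) :
    ∃ e : V ≃ₗ[F] W, e.toLinearMap ∘ₗ i = j := by
  obtain ⟨C, hC⟩ := (range i).exists_isCompl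
  obtain ⟨D, hD⟩ := (range j).exists_isCompl
  have h1 := Submodule.finrank_add_eq_of_isCompl hC
  have h2 := Submodule.finrank_add_eq_of_isCompl hD
  rw [finrank_range_of_inj hi] at h1
  rw [finrank_range_of_inj hj] at h2
  let a := (LinearEquiv.ofInjective i hi).symm.trans (LinearEquiv.ofInjective j hj)
  let b : C ≃ₗ[F] D := LinearEquiv.ofFinrankEq C D (by omega)
  refine ⟨(Submodule.prodEquivOfIsCompl _ _ hC).symm.trans
    ((a.prodCongr b).trans (Submodule.prodEquivOfIsCompl _ _ hD)), ?_⟩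
  ext u
  have : (Submodule.prodEquivOfIsCompl _ _ hC).symm (i u) =
      (LinearEquiv.ofInjective i hi u, 0) := by
    rw [LinearEquiv.symm_apply_eq]
    simp
  simp [this, a]

/-- Two linear maps into spaces of the same dimension agree, up to an isomorphism of the targets,
outside the span of their kernels. -/
theorem exists_linearEquiv_realRank_le (f : U →ₗ[F] V) (g : U →ₗ[F] W)
    (hd : Module.finrank F V = Module.finrank F W) :
    ∃ e : V ≃ₗ[F] W, (e.toLinearMap ∘ₗ f - g).realRank ≤
      Module.finrank F (ker f) + Module.finrank F (ker g) := by
  obtain ⟨S, hS⟩ := (ker f ⊔ ker g).exists_isCompl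
  have hinj : ∀ {Y : Type} [AddCommGroup Y] [Module F Y] (h : U →ₗ[F] Y),
      ker h ≤ ker f ⊔ ker g → Function.Injective (h ∘ₗ S.subtype) := by
    intro Y _ _ h hle
    rw [← ker_eq_bot, eq_bot_iff]
    intro x hx
    have : (x : U) ∈ (ker f ⊔ ker g) ⊓ S := ⟨hle (by simpa using hx), x.2⟩
    rw [hS.inf_eq_bot] at this
    exact Subtype.ext (by simpa using this)
  obtain ⟨e, he⟩ := exists_linearEquiv_comp_eq (f ∘ₗ S.subtype) (g ∘ₗ S.subtype)
    (hinj f le_sup_left) (hinj g le_sup_right) hd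
  refine ⟨e, ?_⟩
  have h1 := realRank_le_of_le_ker (S := S) (g := e.toLinearMap ∘ₗ f - g) (fun x hx => by
    have := congr($he ⟨x, hx⟩)
    simpa [sub_eq_zero] using this)
  have h2 : (Module.finrank F ↥(ker f ⊔ ker g) : ℝ) + Module.finrank F S = Module.finrank F U := by
    exact_mod_cast Submodule.finrank_add_eq_of_isCompl hS
  have h3 : (Module.finrank F ↥(ker f ⊔ ker g) : ℝ) ≤
      Module.finrank F (ker f) + Module.finrank F (ker g) := by
    exact_mod_cast Submodule.finrank_add_le_finrank_add_finrank _ _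
  linarith

/-- Almost idempotent endomorphisms are close to idempotents. -/
theorem exists_idempotent_realRank_sub_le (e : Module.End F V) :
    ∃ f : Module.End F V, f * f = f ∧ realRank (e - f) ≤ realRank (e * e - e) := by
  obtain ⟨p, hp⟩ := (ker (e * e - e)).subtype.exists_leftInverse_of_injective
    (Submodule.ker_subtype _)
  have hp' : ∀ u (hu : u ∈ ker (e * e - e)), (p u : V) = u := fun u hu =>
    congrArg Subtype.val (congr($hp ⟨u, hu⟩))
  have hK : ∀ u ∈ ker (e * e - e), e (e u) = e u := fun u hu => by
    simpa [sub_eq_zero] using hu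
  have hinv : ∀ u ∈ ker (e * e - e), e u ∈ ker (e * e - e) := fun u hu => by
    have := hK u hu
    simp [this]
  refine ⟨e ∘ₗ (ker (e * e - e)).subtype ∘ₗ p, ?_, ?_⟩
  · ext v
    have h1 := hp' _ (hinv _ (p v).2)
    have h2 := hK _ (p v).2
    simp only [Module.End.mul_apply, coe_comp, Function.comp_apply, Submodule.subtype_apply, h1, h2]
  · have h1 := realRank_le_of_le_ker (S := ker (e * e - e))
      (g := e - e ∘ₗ (ker (e * e - e)).subtype ∘ₗ p) (fun x hx => by
        simp [hp' x hx])
    have h2 := realRank_add_finrank_ker (e * e - e)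
    linarith

end RealRank

end LinearMap

theorem Submodule.finrank_iSup_le_sum {F V σ : Type} [Field F] [AddCommGroup V] [Module F V]
    [FiniteDimensional F V] [Fintype σ] (S : σ → Submodule F V) :
    Module.finrank F ↥(⨆ i, S i) ≤ ∑ i, Module.finrank F (S i) := by
  classical
  rw [← Finset.sup_univ_eq_iSup]
  induction (Finset.univ : Finset σ) using Finset.induction_on with
  | empty => simp
  | insert a s ha ih =>
    rw [Finset.sup_insert, Finset.sum_insert ha]
    exact (Submodule.finrank_add_le_finrank_add_finrank _ _).trans (by gcongr)

open LinearMap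

section Representations

variable {F σ κ V W : Type} [Field F]
  [AddCommGroup V] [Module F V] [FiniteDimensional F V]
  [AddCommGroup W] [Module F W] [FiniteDimensional F W]

namespace FreeAlgebra

theorem lift_lift_ι {τ A : Type} [Ring A] [Algebra F A] (g : τ → A) (f : σ → τ)
    (p : FreeAlgebra F σ) :
    lift F g (lift F (fun i => ι F (f i)) p) = lift F (fun i => g (f i)) p := by
  have : (lift F g).comp (lift F (fun i => ι F (f i))) = lift F (fun i => g (f i)) := by
    ext i
    simp
  exact congr($this p)

/-- An approximate intertwiner for the generators approximately intertwines every noncommutative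
polynomial in them. -/
theorem exists_realRank_intertwine_le (p : FreeAlgebra F σ) :
    ∃ C : ℝ, 0 ≤ C ∧ ∀ (V W : Type) [AddCommGroup V] [Module F V] [FiniteDimensional F V]
      [AddCommGroup W] [Module F W] [FiniteDimensional F W]
      (A : σ → Module.End F V) (B : σ → Module.End F W) (φ : V →ₗ[F] W) (c : ℝ), 0 ≤ c →
      (∀ j, realRank (φ ∘ₗ A j - B j ∘ₗ φ) ≤ c) →
      realRank (φ ∘ₗ lift F A p - lift F B p ∘ₗ φ) ≤ C * c := by
  induction p using FreeAlgebra.induction with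
  | grade0 r =>
    refine ⟨0, le_rfl, fun V W _ _ _ _ _ _ A B φ c hc h => ?_⟩
    have : φ ∘ₗ lift F A (algebraMap F _ r) - lift F B (algebraMap F _ r) ∘ₗ φ = 0 := by
      ext v
      simp
    rw [this]
    simp
  | grade1 x =>
    refine ⟨1, zero_le_one, fun V W _ _ _ _ _ _ A B φ c hc h => ?_⟩
    simpa using h x
  | mul p q hp hq =>
    obtain ⟨C, hC, hp⟩ := hp
    obtain ⟨D, hD, hq⟩ := hq
    refine ⟨C + D, add_nonneg hC hD, fun V W _ _ _ _ _ _ A B φ c hc h => ?_⟩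
    have : φ ∘ₗ lift F A (p * q) - lift F B (p * q) ∘ₗ φ =
        (φ ∘ₗ lift F A p - lift F B p ∘ₗ φ) ∘ₗ lift F A q +
          lift F B p ∘ₗ (φ ∘ₗ lift F A q - lift F B q ∘ₗ φ) := by
      ext v
      simp
    rw [this]
    have h1 := realRank_add_le ((φ ∘ₗ lift F A p - lift F B p ∘ₗ φ) ∘ₗ lift F A q)
      (lift F B p ∘ₗ (φ ∘ₗ lift F A q - lift F B q ∘ₗ φ))
    have h2 := realRank_comp_le_left (φ ∘ₗ lift F A p - lift F B p ∘ₗ φ) (lift F A q)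
    have h3 := realRank_comp_le_right (lift F B p) (φ ∘ₗ lift F A q - lift F B q ∘ₗ φ)
    linarith [hp V W A B φ c hc h, hq V W A B φ c hc h]
  | add p q hp hq =>
    obtain ⟨C, hC, hp⟩ := hp
    obtain ⟨D, hD, hq⟩ := hq
    refine ⟨C + D, add_nonneg hC hD, fun V W _ _ _ _ _ _ A B φ c hc h => ?_⟩
    have : φ ∘ₗ lift F A (p + q) - lift F B (p + q) ∘ₗ φ =
        (φ ∘ₗ lift F A p - lift F B p ∘ₗ φ) + (φ ∘ₗ lift F A q - lift F B q ∘ₗ φ) := by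
      ext v
      simp
      abel
    rw [this]
    have h1 := realRank_add_le (φ ∘ₗ lift F A p - lift F B p ∘ₗ φ)
      (φ ∘ₗ lift F A q - lift F B q ∘ₗ φ)
    linarith [hp V W A B φ c hc h, hq V W A B φ c hc h]

theorem exists_forall_realRank_intertwine_le [Finite κ] (P : κ → FreeAlgebra F σ) :
    ∃ C : ℝ, 0 ≤ C ∧ ∀ (V W : Type) [AddCommGroup V] [Module F V] [FiniteDimensional F V]
      [AddCommGroup W] [Module F W] [FiniteDimensional F W]
      (A : σ → Module.End F V) (B : σ → Module.End F W) (φ : V →ₗ[F] W) (c : ℝ), 0 ≤ c →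
      (∀ j, realRank (φ ∘ₗ A j - B j ∘ₗ φ) ≤ c) →
      ∀ i, realRank (φ ∘ₗ lift F A (P i) - lift F B (P i) ∘ₗ φ) ≤ C * c := by
  have := Fintype.ofFinite κ
  choose C hC h using fun i => exists_realRank_intertwine_le (P i)
  refine ⟨∑ i, C i, Finset.sum_nonneg fun i _ => hC i,
    fun V W _ _ _ _ _ _ A B φ c hc hφ i => (h i V W A B φ c hc hφ).trans ?_⟩
  gcongr
  exact Finset.single_le_sum (fun i _ => hC i) (Finset.mem_univ i)

theorem comp_lift_eq_lift_comp {A : σ → Module.End F V} {B : σ → Module.End F W}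
    {φ : V →ₗ[F] W} (h : ∀ j, φ ∘ₗ A j = B j ∘ₗ φ) (p : FreeAlgebra F σ) :
    φ ∘ₗ lift F A p = lift F B p ∘ₗ φ := by
  obtain ⟨C, -, hC⟩ := exists_realRank_intertwine_le p
  have := hC V W A B φ 0 le_rfl (fun j => by simp [h j])
  exact sub_eq_zero.1 (eq_zero_of_realRank_nonpos (by simpa using this))

end FreeAlgebra

open FreeAlgebra

/-- Two tuples of endomorphisms are within `c` of each other if some linear map between the
underlying spaces, with small kernel and between spaces of almost equal dimensions, intertwines
them up to small rank. -/
def IsNear (c : ℝ) (A : σ → Module.End F V) (B : σ → Module.End F W) : Prop :=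
  ∃ φ : V →ₗ[F] W, Module.finrank F (ker φ) ≤ c ∧
    |(Module.finrank F V : ℝ) - Module.finrank F W| ≤ c ∧
    ∀ j, realRank (φ ∘ₗ A j - B j ∘ₗ φ) ≤ c

/-- A form of rank-stability in terms of endomorphisms of vector spaces, which also controls the
dimension of the space carrying the exact solution. -/
def LinearRankStable (P : κ → FreeAlgebra F σ) : Prop :=
  ∀ ε : ℝ, 0 < ε → ∃ δ : ℝ, 0 < δ ∧
    ∀ (V : Type) [AddCommGroup V] [Module F V] [FiniteDimensional F V]
      (A : σ → Module.End F V) (N : ℝ), Module.finrank F V ≤ N →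
      (∀ i, realRank (lift F A (P i)) ≤ δ * N) →
      ∃ (W : Type) (_ : AddCommGroup W) (_ : Module F W) (_ : FiniteDimensional F W)
        (B : σ → Module.End F W), (∀ i, lift F B (P i) = 0) ∧ IsNear (ε * N) A B

/-- An approximate solution on the image of an idempotent, up to small rank, is close to an exact
solution on another space. -/
theorem LinearRankStable.exists_of_idempotent [Finite κ] {P : κ → FreeAlgebra F σ}
    (hP : LinearRankStable P) {ε : ℝ} (hε : 0 < ε) :
    ∃ δ : ℝ, 0 < δ ∧
    ∀ (V : Type) [AddCommGroup V] [Module F V] [FiniteDimensional F V]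
      (f : Module.End F V) (X : σ → Module.End F V) (N : ℝ), f * f = f → Module.finrank F V ≤ N →
      (∀ j, realRank (X j * f - X j) ≤ δ * N) → (∀ i, realRank (f * lift F X (P i)) ≤ δ * N) →
      ∃ (W : Type) (_ : AddCommGroup W) (_ : Module F W) (_ : FiniteDimensional F W)
        (B : σ → Module.End F W) (φ : range f →ₗ[F] W), (∀ i, lift F B (P i) = 0) ∧
        Module.finrank F (ker φ) ≤ ε * N ∧
        |(Module.finrank F (range f) : ℝ) - Module.finrank F W| ≤ ε * N ∧
        ∀ j, realRank ((φ ∘ₗ f.rangeRestrict) ∘ₗ X j - B j ∘ₗ φ ∘ₗ f.rangeRestrict) ≤ ε * N := by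
  obtain ⟨δ₀, hδ₀, hst⟩ := hP (ε / 2) (half_pos hε)
  obtain ⟨C, hC, hlip⟩ := exists_forall_realRank_intertwine_le P
  refine ⟨min (ε / 2) (δ₀ / (C + 1)), by positivity, fun V _ _ _ f X N hf hN hX hfP => ?_⟩
  set δ := min (ε / 2) (δ₀ / (C + 1)) with hδ
  have hN0 : 0 ≤ N := (Nat.cast_nonneg _).trans hN
  have hδ0 : 0 < δ := by positivity
  have hδε : δ * N ≤ ε / 2 * N := by gcongr; exact min_le_left _ _
  have hδC : (C + 1) * (δ * N) ≤ δ₀ * N := by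
    have : δ ≤ δ₀ / (C + 1) := min_le_right _ _
    rw [le_div_iff₀ (by positivity)] at this
    nlinarith
  set π : V →ₗ[F] range f := f.rangeRestrict with hπ
  have hff : ∀ v, f (f v) = f v := fun v => congr($hf v)
  have hπf : π ∘ₗ f = π := by
    ext v
    simp [hπ, hff]
  have hπι : π ∘ₗ (range f).subtype = LinearMap.id := by
    ext ⟨_, v, rfl⟩
    simp [hπ, hff]
  let A : σ → Module.End F (range f) := fun j => π ∘ₗ X j ∘ₗ (range f).subtype
  have hA : ∀ j, realRank (π ∘ₗ X j - A j ∘ₗ π) ≤ δ * N := fun j => by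
    have : π ∘ₗ X j - A j ∘ₗ π = -(π ∘ₗ (X j * f - X j)) := by
      ext v
      simp [A, hπ]
    rw [this, realRank_neg]
    exact (realRank_comp_le_right _ _).trans (hX j)
  obtain ⟨W, _, _, _, B, hB, φ, hker, hdim, hφ⟩ := hst (range f) A N
    (le_trans (by exact_mod_cast Submodule.finrank_le _) hN) (fun i => by
      have e1 : lift F A (P i) = (lift F A (P i) ∘ₗ π) ∘ₗ (range f).subtype := by
        rw [comp_assoc, hπι, comp_id]
      have e2 : lift F A (P i) ∘ₗ π = π ∘ₗ (f * lift F X (P i)) -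
          (π ∘ₗ lift F X (P i) - lift F A (P i) ∘ₗ π) := by
        rw [Module.End.mul_eq_comp, ← comp_assoc, hπf]
        abel
      rw [e1]
      refine (realRank_comp_le_left _ _).trans ?_
      rw [e2]
      refine (realRank_sub_le _ _).trans ?_
      have h1 := hlip V (range f) X A π (δ * N) (by positivity) hA i
      have h2 := realRank_comp_le_right π (f * lift F X (P i))
      linarith [hfP i])
  refine ⟨W, inferInstance, inferInstance, inferInstance, B, φ, hB, hker.trans ?_, hdim.trans ?_,
    fun j => ?_⟩
  · nlinarith
  · nlinarith
  · have : (φ ∘ₗ π) ∘ₗ X j - B j ∘ₗ φ ∘ₗ π =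
        φ ∘ₗ (π ∘ₗ X j - A j ∘ₗ π) + (φ ∘ₗ A j - B j ∘ₗ φ) ∘ₗ π := by
      ext v
      simp
    rw [this]
    refine (realRank_add_le _ _).trans ?_
    have h1 := realRank_comp_le_right φ (π ∘ₗ X j - A j ∘ₗ π)
    have h2 := realRank_comp_le_left (φ ∘ₗ A j - B j ∘ₗ φ) π
    linarith [hA j, hφ j]

theorem forall_lift_directProductRels_iff {d t r s : ℕ} (P : Fin r → FreeAlgebra F (Fin d))
    (Q : Fin s → FreeAlgebra F (Fin t)) (g : (Fin d ⊕ Fin t) ⊕ Fin 2 → Module.End F V)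
    (p : Module.End F V → Prop) :
    (∀ k, p (lift F g (directProductRels F P Q k))) ↔
      ((∀ j, p (g (.inr 0) * lift F (fun i => g (.inl (.inl i))) (P j))) ∧
        ∀ j, p (g (.inr 1) * lift F (fun i => g (.inl (.inr i))) (Q j))) ∧
      (((∀ i, p (g (.inr 0) * g (.inl (.inl i)) - g (.inl (.inl i)))) ∧
          ∀ i, p (g (.inl (.inl i)) * g (.inr 0) - g (.inl (.inl i)))) ∧
        ((∀ i, p (g (.inr 1) * g (.inl (.inr i)) - g (.inl (.inr i)))) ∧
          ∀ i, p (g (.inl (.inr i)) * g (.inr 1) - g (.inl (.inr i))))) ∧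
      p (g (.inr 0) + g (.inr 1) - 1) ∧ p (g (.inr 0) * g (.inr 0) - g (.inr 0)) ∧
        p (g (.inr 1) * g (.inr 1) - g (.inr 1)) := by
  have e1 := lift_lift_ι (F := F) g (fun i : Fin d => Sum.inl (Sum.inl i))
  have e2 := lift_lift_ι (F := F) g (fun i : Fin t => Sum.inl (Sum.inr i))
  simp [directProductRels, Sum.forall, Fin.forall_fin_succ, e1, e2]

theorem LinearRankStable.left_of_directProduct {d t r s : ℕ} {P : Fin r → FreeAlgebra F (Fin d)}
    {Q : Fin s → FreeAlgebra F (Fin t)} (h : LinearRankStable (directProductRels F P Q)) :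
    LinearRankStable P := by
  intro ε hε
  obtain ⟨δ, hδ, hst⟩ := h (ε / 2) (half_pos hε)
  refine ⟨δ, hδ, fun V _ _ _ A N hN hA => ?_⟩
  have hN0 : 0 ≤ N := (Nat.cast_nonneg _).trans hN
  obtain ⟨W, _, _, _, B, hB, φ, hker, hdim, hφ⟩ := hst V
    (Sum.elim (Sum.elim A fun _ => 0) ![1, 0]) N hN (by
      rw [forall_lift_directProductRels_iff P Q _ (fun g => realRank g ≤ δ * N)]
      have : 0 ≤ δ * N := by positivity
      simpa [this] using hA)
  rw [forall_lift_directProductRels_iff P Q _ (fun g => g = 0)] at hB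
  obtain ⟨⟨hP, -⟩, ⟨⟨hl, hr⟩, -⟩, -, he, -⟩ := hB
  simp only [sub_eq_zero] at hl hr he
  set e := B (.inr 0)
  set X : Fin d → Module.End F W := fun i => B (.inl (.inl i))
  have hee : ∀ v, e (e v) = e v := fun v => congr($he v)
  set π : W →ₗ[F] range e := e.rangeRestrict with hπ
  have hπe : π ∘ₗ e = π := by
    ext v
    simp [hπ, hee]
  have hπι : π ∘ₗ (range e).subtype = LinearMap.id := by
    ext ⟨_, v, rfl⟩
    simp [hπ, hee]
  have hφe : realRank (φ - e ∘ₗ φ) ≤ ε / 2 * N := by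
    simpa [Module.End.one_eq_id] using hφ (.inr 0)
  have hφX : ∀ j, realRank (φ ∘ₗ A j - X j ∘ₗ φ) ≤ ε / 2 * N := fun j => by
    simpa using hφ (.inl (.inl j))
  have hXe : ∀ j v, X j (e v) = X j v := fun j v => congr($(hr j) v)
  have heX : ∀ j v, e (X j v) = X j v := fun j v => congr($(hl j) v)
  let Y : Fin d → Module.End F (range e) := fun j => π ∘ₗ X j ∘ₗ (range e).subtype
  have hY : ∀ j, (range e).subtype ∘ₗ Y j = X j ∘ₗ (range e).subtype := fun j => by
    ext v
    simp [Y, hπ, heX]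
  have hk : (Module.finrank F (ker (π ∘ₗ φ)) : ℝ) ≤ ε * N := by
    have h1 := realRank_add_finrank_ker (π ∘ₗ φ)
    have h2 := realRank_add_finrank_ker φ
    have h3 := realRank_add_le (φ - e ∘ₗ φ) (e ∘ₗ φ)
    rw [sub_add_cancel] at h3
    have h4 : e ∘ₗ φ = (range e).subtype ∘ₗ π ∘ₗ φ := rfl
    have h5 := realRank_comp_le_right (range e).subtype (π ∘ₗ φ)
    rw [← h4] at h5
    linarith
  refine ⟨range e, inferInstance, inferInstance, inferInstance, Y, fun i => ?_, π ∘ₗ φ, hk, ?_,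
    fun j => ?_⟩
  · calc lift F Y (P i) = π ∘ₗ ((range e).subtype ∘ₗ lift F Y (P i)) := by
          rw [← comp_assoc, hπι, id_comp]
      _ = π ∘ₗ (e * lift F X (P i)) ∘ₗ (range e).subtype := by
          simp only [comp_lift_eq_lift_comp hY, Module.End.mul_eq_comp, ← comp_assoc, hπe]
      _ = 0 := by
          rw [hP i]
          simp
  · have h1 := realRank_add_finrank_ker (π ∘ₗ φ)
    have h2 := realRank_le_finrank_codomain (π ∘ₗ φ)
    have h3 : (Module.finrank F (range e) : ℝ) ≤ Module.finrank F W := by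
      exact_mod_cast Submodule.finrank_le _
    rw [abs_le] at hdim ⊢
    constructor <;> nlinarith
  · have : (π ∘ₗ φ) ∘ₗ A j - Y j ∘ₗ π ∘ₗ φ = π ∘ₗ (φ ∘ₗ A j - X j ∘ₗ φ) := by
      ext v
      simp [Y, hπ, hXe]
    rw [this]
    have := realRank_comp_le_right π (φ ∘ₗ A j - X j ∘ₗ φ)
    nlinarith [hφX j]


theorem LinearRankStable.directProduct_swap {d t r s : ℕ} {P : Fin r → FreeAlgebra F (Fin d)}
    {Q : Fin s → FreeAlgebra F (Fin t)} (h : LinearRankStable (directProductRels F P Q)) :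
    LinearRankStable (directProductRels F Q P) := by
  intro ε hε
  obtain ⟨δ, hδ, hst⟩ := h ε hε
  refine ⟨δ, hδ, fun V _ _ _ A N hN hA => ?_⟩
  rw [forall_lift_directProductRels_iff Q P _ (fun g => realRank g ≤ δ * N)] at hA
  obtain ⟨⟨a1, a2⟩, ⟨⟨a3, a4⟩, a5, a6⟩, a7, a8, a9⟩ := hA
  obtain ⟨W, _, _, _, B, hB, φ, hker, hdim, hφ⟩ := hst V
    (fun k => A (Sum.map Sum.swap ![1, 0] k)) N hN (by
      rw [forall_lift_directProductRels_iff P Q _ (fun g => realRank g ≤ δ * N)]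
      exact ⟨⟨a2, a1⟩, ⟨⟨a5, a6⟩, a3, a4⟩, (add_comm (A (.inr 0)) _) ▸ a7, a9, a8⟩)
  rw [forall_lift_directProductRels_iff P Q _ (fun g => g = 0)] at hB
  obtain ⟨⟨b1, b2⟩, ⟨⟨b3, b4⟩, b5, b6⟩, b7, b8, b9⟩ := hB
  refine ⟨W, inferInstance, inferInstance, inferInstance,
    fun k => B (Sum.map Sum.swap ![1, 0] k), ?_, φ, hker, hdim, ?_⟩
  · rw [forall_lift_directProductRels_iff Q P _ (fun g => g = 0)]
    exact ⟨⟨b2, b1⟩, ⟨⟨b5, b6⟩, b3, b4⟩, (add_comm (B (.inr 0)) _) ▸ b7, b9, b8⟩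
  · rintro ((j | j) | j)
    · exact hφ (.inl (.inr j))
    · exact hφ (.inl (.inl j))
    · fin_cases j
      · exact hφ (.inr 1)
      · exact hφ (.inr 0)

namespace LinearMap

theorem realRank_mul_sub_self_le (e f X : Module.End F V) :
    realRank (X * f - X) ≤ realRank (X * e - X) + realRank (e - f) := by
  have : X * f - X = (X * e - X) - X * (e - f) := by noncomm_ring
  rw [this]
  exact (realRank_sub_le _ _).trans (by gcongr; exact realRank_comp_le_right _ _)

theorem realRank_sub_self_mul_le (e f X : Module.End F V) :
    realRank (f * X - X) ≤ realRank (e * X - X) + realRank (e - f) := by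
  have : f * X - X = (e * X - X) - (e - f) * X := by noncomm_ring
  rw [this]
  exact (realRank_sub_le _ _).trans (by gcongr; exact realRank_comp_le_left _ _)

theorem realRank_mul_le_add (e f X : Module.End F V) :
    realRank (f * X) ≤ realRank (e * X) + realRank (e - f) := by
  have : f * X = e * X - (e - f) * X := by noncomm_ring
  rw [this]
  exact (realRank_sub_le _ _).trans (by gcongr; exact realRank_comp_le_left _ _)

variable {U : Type} [AddCommGroup U] [Module F U] [FiniteDimensional F U]

theorem realRank_prod_le (g : U →ₗ[F] V) (h : U →ₗ[F] W) :
    realRank (g.prod h) ≤ realRank g + realRank h := by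
  have : g.prod h = inl F V W ∘ₗ g + inr F V W ∘ₗ h := by
    ext v <;> simp
  rw [this]
  exact (realRank_add_le _ _).trans
    (add_le_add (realRank_comp_le_right _ _) (realRank_comp_le_right _ _))

theorem finrank_ker_prodMap_le {X : Type} [AddCommGroup X] [Module F X] [FiniteDimensional F X]
    (g : U →ₗ[F] V) (h : X →ₗ[F] W) :
    (Module.finrank F (ker (g.prodMap h)) : ℝ) ≤
      Module.finrank F (ker g) + Module.finrank F (ker h) := by
  rw [ker_prodMap, ← Nat.cast_add, ← Module.finrank_prod]
  let m : (ker g).prod (ker h) →ₗ[F] ker g × ker h :=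
    ((LinearMap.fst F U X).restrict (p := (ker g).prod (ker h)) (q := ker g) fun x hx => hx.1).prod
      ((LinearMap.snd F U X).restrict (p := (ker g).prod (ker h)) (q := ker h) fun x hx => hx.2)
  have hm : Function.Injective m := fun x y hxy => by
    have h1 := congrArg (fun z : ker g × ker h => (z.1 : U)) hxy
    have h2 := congrArg (fun z : ker g × ker h => (z.2 : X)) hxy
    exact Subtype.ext (Prod.ext h1 h2)
  exact_mod_cast finrank_le_finrank_of_injective hm

end LinearMap

theorem LinearRankStable.directProduct {d t r s : ℕ} {P : Fin r → FreeAlgebra F (Fin d)}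
    {Q : Fin s → FreeAlgebra F (Fin t)} (hP : LinearRankStable P) (hQ : LinearRankStable Q) :
    LinearRankStable (directProductRels F P Q) := by
  intro ε hε
  obtain ⟨δ₁, hδ₁, hst₁⟩ := hP.exists_of_idempotent (half_pos hε)
  obtain ⟨δ₂, hδ₂, hst₂⟩ := hQ.exists_of_idempotent (half_pos hε)
  refine ⟨min (ε / 8) (min (δ₁ / 4) (δ₂ / 4)), by positivity, fun V _ _ _ A N hN hA => ?_⟩
  set δ := min (ε / 8) (min (δ₁ / 4) (δ₂ / 4)) with hδ
  have hN0 : 0 ≤ N := (Nat.cast_nonneg _).trans hN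
  have hδ0 : 0 < δ := by positivity
  have hδN : 0 ≤ δ * N := by positivity
  have hδε : 8 * (δ * N) ≤ ε * N := by
    have : δ ≤ ε / 8 := min_le_left _ _
    nlinarith
  have hδδ₁ : 4 * (δ * N) ≤ δ₁ * N := by
    have : δ ≤ δ₁ / 4 := (min_le_right _ _).trans (min_le_left _ _)
    nlinarith
  have hδδ₂ : 4 * (δ * N) ≤ δ₂ * N := by
    have : δ ≤ δ₂ / 4 := (min_le_right _ _).trans (min_le_right _ _)
    nlinarith
  rw [forall_lift_directProductRels_iff P Q _ (fun g => realRank g ≤ δ * N)] at hA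
  obtain ⟨⟨hAP, hAQ⟩, ⟨⟨hlX, hrX⟩, hlY, hrY⟩, hsum, hid, -⟩ := hA
  set e₁ := A (.inr 0) with he₁
  set e₂ := A (.inr 1) with he₂
  set X : Fin d → Module.End F V := fun i => A (.inl (.inl i)) with hX
  set Y : Fin t → Module.End F V := fun i => A (.inl (.inr i)) with hY
  obtain ⟨f, hf, hef⟩ := exists_idempotent_realRank_sub_le e₁
  replace hef := hef.trans hid
  have hf' : (1 - f) * (1 - f) = 1 - f := by
    have : (1 - f) * (1 - f) = 1 - f - f + f * f := by noncomm_ring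
    rw [this, hf]
    abel
  have hef' : realRank (e₂ - (1 - f)) ≤ 2 * (δ * N) := by
    have : e₂ - (1 - f) = (e₁ + e₂ - 1) - (e₁ - f) := by abel
    rw [this]
    linarith [realRank_sub_le (e₁ + e₂ - 1) (e₁ - f)]
  obtain ⟨W₁, _, _, _, B₁, φ₁, hB₁, hker₁, hdim₁, hφ₁⟩ := hst₁ V f X N hf hN
    (fun j => by linarith [realRank_mul_sub_self_le e₁ f (X j), hrX j])
    (fun i => by linarith [realRank_mul_le_add e₁ f (FreeAlgebra.lift F X (P i)), hAP i])
  obtain ⟨W₂, _, _, _, B₂, φ₂, hB₂, hker₂, hdim₂, hφ₂⟩ := hst₂ V (1 - f) Y N hf' hN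
    (fun j => by linarith [realRank_mul_sub_self_le e₂ (1 - f) (Y j), hrY j])
    (fun i => by linarith [realRank_mul_le_add e₂ (1 - f) (FreeAlgebra.lift F Y (Q i)), hAQ i])
  have hff : ∀ v, f (f v) = f v := fun v => congr($hf v)
  set π₁ : V →ₗ[F] range f := f.rangeRestrict with hπ₁
  set π₂ : V →ₗ[F] range (1 - f) := (1 - f).rangeRestrict with hπ₂
  have hπ₁f : ∀ v, π₁ (f v) = π₁ v := fun v => Subtype.ext (hff v)
  have hπ₂f : ∀ v, π₂ (f v) = 0 := fun v => by
    apply Subtype.ext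
    simp [hπ₂, hff]
  set ψ₁ : V →ₗ[F] W₁ := φ₁ ∘ₗ π₁ with hψ₁
  set ψ₂ : V →ₗ[F] W₂ := φ₂ ∘ₗ π₂ with hψ₂
  have hψ₁f : ∀ v, ψ₁ (f v) = ψ₁ v := fun v => by simp [hψ₁, hπ₁f]
  have hψ₂f : ∀ v, ψ₂ (f v) = 0 := fun v => by simp [hψ₂, hπ₂f]
  let B : (Fin d ⊕ Fin t) ⊕ Fin 2 → Module.End F (W₁ × W₂) :=
    Sum.elim
      (Sum.elim (fun i => inl F W₁ W₂ ∘ₗ B₁ i ∘ₗ fst F W₁ W₂)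
        (fun i => inr F W₁ W₂ ∘ₗ B₂ i ∘ₗ snd F W₁ W₂))
      ![inl F W₁ W₂ ∘ₗ fst F W₁ W₂, inr F W₁ W₂ ∘ₗ snd F W₁ W₂]
  refine ⟨W₁ × W₂, inferInstance, inferInstance, inferInstance, B, ?_, ψ₁.prod ψ₂, ?_, ?_, ?_⟩
  · rw [forall_lift_directProductRels_iff P Q _ (fun g => g = 0)]
    refine ⟨⟨fun i => ?_, fun i => ?_⟩, ⟨⟨fun i => ?_, fun i => ?_⟩, fun i => ?_, fun i => ?_⟩,
      ?_, ?_, ?_⟩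
    · have h := comp_lift_eq_lift_comp (A := fun i => B (.inl (.inl i))) (B := B₁)
        (φ := fst F W₁ W₂) (fun j => by ext <;> simp [B]) (P i)
      rw [hB₁, zero_comp] at h
      change inl F W₁ W₂ ∘ₗ (fst F W₁ W₂ ∘ₗ _) = 0
      rw [h, comp_zero]
    · have h := comp_lift_eq_lift_comp (A := fun i => B (.inl (.inr i))) (B := B₂)
        (φ := snd F W₁ W₂) (fun j => by ext <;> simp [B]) (Q i)
      rw [hB₂, zero_comp] at h
      change inr F W₁ W₂ ∘ₗ (snd F W₁ W₂ ∘ₗ _) = 0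
      rw [h, comp_zero]
    all_goals
      ext <;> simp [B]
  · have h1 : ψ₁.prod ψ₂ = φ₁.prodMap φ₂ ∘ₗ π₁.prod π₂ := rfl
    have h2 : ker (π₁.prod π₂) = ⊥ := by
      rw [ker_eq_bot']
      intro v hv
      have h3 : f v = 0 := congrArg (fun z : range f × range (1 - f) => (z.1 : V)) hv
      have h4 : v - f v = 0 := congrArg (fun z : range f × range (1 - f) => (z.2 : V)) hv
      rwa [h3, sub_zero] at h4
    have h3 := finrank_ker_comp_le (φ₁.prodMap φ₂) (π₁.prod π₂)
    rw [h2, finrank_bot, Nat.cast_zero, add_zero] at h3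
    have h4 := finrank_ker_prodMap_le φ₁ φ₂
    rw [h1]
    linarith
  · have h1 : range (1 - f) = ker f := by
      ext v
      constructor
      · rintro ⟨v, rfl⟩
        simp [hff]
      · intro hv
        exact ⟨v, by simpa using hv⟩
    have h2 : (Module.finrank F (range f) : ℝ) + Module.finrank F (range (1 - f)) =
        Module.finrank F V := by
      rw [h1]
      exact realRank_add_finrank_ker f
    rw [Module.finrank_prod, Nat.cast_add, ← h2]
    rw [abs_le] at hdim₁ hdim₂ ⊢
    constructor <;> linarith
  · rintro ((j | j) | j)
    · have h1 : ψ₁.prod ψ₂ ∘ₗ X j - B (.inl (.inl j)) ∘ₗ ψ₁.prod ψ₂ =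
          (ψ₁ ∘ₗ X j - B₁ j ∘ₗ ψ₁).prod (-(ψ₂ ∘ₗ (f * X j - X j))) := by
        ext v <;> simp [B, hψ₂f]
      have h2 := realRank_comp_le_right ψ₂ (f * X j - X j)
      have h3 := realRank_sub_self_mul_le e₁ f (X j)
      have h4 := realRank_prod_le (ψ₁ ∘ₗ X j - B₁ j ∘ₗ ψ₁) (-(ψ₂ ∘ₗ (f * X j - X j)))
      rw [realRank_neg] at h4
      change realRank (ψ₁.prod ψ₂ ∘ₗ X j - B (.inl (.inl j)) ∘ₗ ψ₁.prod ψ₂) ≤ _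
      rw [h1]
      linarith [hφ₁ j, hlX j]
    · have h1 : ψ₁.prod ψ₂ ∘ₗ Y j - B (.inl (.inr j)) ∘ₗ ψ₁.prod ψ₂ =
          (-(ψ₁ ∘ₗ ((1 - f) * Y j - Y j))).prod (ψ₂ ∘ₗ Y j - B₂ j ∘ₗ ψ₂) := by
        ext v <;> simp [B, hψ₁f]
      have h2 := realRank_comp_le_right ψ₁ ((1 - f) * Y j - Y j)
      have h3 := realRank_sub_self_mul_le e₂ (1 - f) (Y j)
      have h4 := realRank_prod_le (-(ψ₁ ∘ₗ ((1 - f) * Y j - Y j))) (ψ₂ ∘ₗ Y j - B₂ j ∘ₗ ψ₂)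
      rw [realRank_neg] at h4
      change realRank (ψ₁.prod ψ₂ ∘ₗ Y j - B (.inl (.inr j)) ∘ₗ ψ₁.prod ψ₂) ≤ _
      rw [h1]
      linarith [hφ₂ j, hlY j]
    · fin_cases j
      · have h1 : ψ₁.prod ψ₂ ∘ₗ e₁ - B (.inr 0) ∘ₗ ψ₁.prod ψ₂ = ψ₁.prod ψ₂ ∘ₗ (e₁ - f) := by
          ext v <;> simp [B, hψ₁f, hψ₂f]
        have h2 := realRank_comp_le_right (ψ₁.prod ψ₂) (e₁ - f)
        change realRank (ψ₁.prod ψ₂ ∘ₗ e₁ - B (.inr 0) ∘ₗ ψ₁.prod ψ₂) ≤ _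
        rw [h1]
        linarith
      · have h1 : ψ₁.prod ψ₂ ∘ₗ e₂ - B (.inr 1) ∘ₗ ψ₁.prod ψ₂ =
            ψ₁.prod ψ₂ ∘ₗ (e₂ - (1 - f)) := by
          ext v <;> simp [B, hψ₁f, hψ₂f]
        have h2 := realRank_comp_le_right (ψ₁.prod ψ₂) (e₂ - (1 - f))
        change realRank (ψ₁.prod ψ₂ ∘ₗ e₂ - B (.inr 1) ∘ₗ ψ₁.prod ψ₂) ≤ _
        rw [h1]
        linarith

/-- An exact solution on a larger space can be cut down to a space of controlled dimension. -/
theorem exists_isNear_of_expansion [Fintype σ] {P : κ → FreeAlgebra F σ}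
    {A : σ → Module.End F V} {B : σ → Module.End F W} {J : V →ₗ[F] W} {K : W →ₗ[F] V}
    (hKJ : K ∘ₗ J = LinearMap.id) {c : ℝ} (hc : 0 ≤ c)
    (hAB : ∀ j, realRank (J ∘ₗ A j ∘ₗ K - B j) ≤ c) (hB : ∀ i, FreeAlgebra.lift F B (P i) = 0) :
    ∃ (W' : Type) (_ : AddCommGroup W') (_ : Module F W') (_ : FiniteDimensional F W')
      (B' : σ → Module.End F W'), (∀ i, FreeAlgebra.lift F B' (P i) = 0) ∧
        IsNear ((Fintype.card σ + 1) * c) A B' := by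
  have hKJ' : ∀ v, K (J v) = v := fun v => congr($hKJ v)
  set S : Submodule F W := range J ⊔ ⨆ j, range (J ∘ₗ A j ∘ₗ K - B j) with hS
  have hBS : ∀ j w, B j w ∈ S := fun j w => by
    have : B j w = J (A j (K w)) - (J ∘ₗ A j ∘ₗ K - B j) w := by simp
    rw [this]
    exact S.sub_mem (le_sup_left (a := range J) ⟨_, rfl⟩)
      (le_sup_right (a := range J) (Submodule.mem_iSup_of_mem j ⟨w, rfl⟩))
  have hdimS : (Module.finrank F S : ℝ) ≤ Module.finrank F V + Fintype.card σ * c := by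
    have h1 : (Module.finrank F S : ℝ) ≤
        realRank J + ∑ j, realRank (J ∘ₗ A j ∘ₗ K - B j) := by
      unfold realRank
      exact_mod_cast (Submodule.finrank_add_le_finrank_add_finrank _ _).trans
        (by gcongr; exact Submodule.finrank_iSup_le_sum _)
    have h2 : ∑ j, realRank (J ∘ₗ A j ∘ₗ K - B j) ≤ Fintype.card σ * c := by
      simpa using Finset.sum_le_sum (s := Finset.univ) fun j _ => hAB j
    linarith [realRank_le_finrank J]
  let B' : σ → Module.End F S := fun j => (B j).restrict fun w _ => hBS j w
  let φ : V →ₗ[F] S := J.codRestrict S fun v => le_sup_left (a := range J) ⟨v, rfl⟩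
  have hφ : ker φ = ⊥ := by
    rw [ker_eq_bot']
    intro v hv
    have : J v = 0 := congrArg Subtype.val hv
    rw [← hKJ' v, this, map_zero]
  have hdimV : (Module.finrank F V : ℝ) ≤ Module.finrank F S := by
    exact_mod_cast finrank_le_finrank_of_injective (ker_eq_bot.1 hφ)
  obtain ⟨p, hp⟩ := S.subtype.exists_leftInverse_of_injective S.ker_subtype
  have hcard : 0 ≤ (Fintype.card σ : ℝ) * c := by positivity
  refine ⟨S, inferInstance, inferInstance, inferInstance, B', fun i => ?_, φ, ?_, ?_, fun j => ?_⟩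
  · have h := comp_lift_eq_lift_comp (A := B') (B := B) (φ := S.subtype) (fun j => rfl) (P i)
    rw [hB, zero_comp] at h
    rw [← id_comp (FreeAlgebra.lift F B' (P i)), ← hp, comp_assoc, h, comp_zero]
  · rw [hφ, finrank_bot, Nat.cast_zero]
    positivity
  · rw [abs_le]
    constructor <;> linarith
  · have h1 : φ ∘ₗ A j - B' j ∘ₗ φ = p ∘ₗ (J ∘ₗ A j ∘ₗ K - B j) ∘ₗ J := by
      have h2 : S.subtype ∘ₗ (φ ∘ₗ A j - B' j ∘ₗ φ) = (J ∘ₗ A j ∘ₗ K - B j) ∘ₗ J := by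
        ext v
        simp [φ, B', hKJ']
      rw [← h2, ← comp_assoc, hp, id_comp]
    rw [h1]
    have h3 := realRank_comp_le_right p ((J ∘ₗ A j ∘ₗ K - B j) ∘ₗ J)
    have h4 := realRank_comp_le_left (J ∘ₗ A j ∘ₗ K - B j) J
    linarith [hAB j]

theorem FreeAlgebra.lift_zero_eq_algebraMap {R : Type} [Ring R] [Algebra F R]
    (p : FreeAlgebra F σ) :
    FreeAlgebra.lift F (0 : σ → R) p = algebraMap F R (FreeAlgebra.algebraMapInv p) := by
  have : FreeAlgebra.lift F (0 : σ → R) = (Algebra.ofId F R).comp FreeAlgebra.algebraMapInv := by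
    ext i
    simp [FreeAlgebra.algebraMapInv]
  exact congr($this p)

/-- An exact solution extended by zero satisfies the relations up to their constant terms. -/
theorem FreeAlgebra.lift_extend_of_eq_zero {B : σ → Module.End F W} {J : W →ₗ[F] V}
    {K : V →ₗ[F] W} (hKJ : K ∘ₗ J = LinearMap.id) {p : FreeAlgebra F σ}
    (hp : FreeAlgebra.lift F B p = 0) :
    FreeAlgebra.lift F (fun j => (J ∘ₗ B j ∘ₗ K : Module.End F V)) p =
      FreeAlgebra.algebraMapInv p • (LinearMap.id - J ∘ₗ K) := by
  have hKJ' : ∀ v, K (J v) = v := fun v => congr($hKJ v)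
  have h1 := comp_lift_eq_lift_comp (A := B) (B := fun j => (J ∘ₗ B j ∘ₗ K : Module.End F V))
    (φ := J) (fun j => by ext v; simp [hKJ']) p
  have h2 := comp_lift_eq_lift_comp (A := (0 : σ → Module.End F V))
    (B := fun j => (J ∘ₗ B j ∘ₗ K : Module.End F V))
    (φ := LinearMap.id - J ∘ₗ K) (fun j => by ext v; simp [hKJ']) p
  rw [hp, comp_zero] at h1
  rw [FreeAlgebra.lift_zero_eq_algebraMap] at h2
  ext v
  have h3 := congr($h1 (K v))
  have h4 := congr($h2 v)
  simp only [LinearMap.zero_apply, LinearMap.comp_apply, LinearMap.sub_apply, id_apply,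
    Module.algebraMap_end_apply, map_smul,
    map_sub] at h3 h4
  rw [← h3, sub_zero] at h4
  rw [← h4]
  simp

/-- An exact solution on a smaller space is near a given approximate solution on a larger space,
unless the relations have no constant terms and the solution can be extended by zero. -/
theorem exists_isNear_of_contraction {P : κ → FreeAlgebra F σ} {C : ℝ} (hC : 0 ≤ C)
    (hlip : ∀ (V W : Type) [AddCommGroup V] [Module F V] [FiniteDimensional F V]
      [AddCommGroup W] [Module F W] [FiniteDimensional F W]
      (A : σ → Module.End F V) (B : σ → Module.End F W) (φ : V →ₗ[F] W) (c : ℝ), 0 ≤ c →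
      (∀ j, realRank (φ ∘ₗ A j - B j ∘ₗ φ) ≤ c) →
      ∀ i, realRank (φ ∘ₗ FreeAlgebra.lift F A (P i) - FreeAlgebra.lift F B (P i) ∘ₗ φ) ≤ C * c)
    {A : σ → Module.End F V} {B : σ → Module.End F W} {J : W →ₗ[F] V} {K : V →ₗ[F] W}
    (hKJ : K ∘ₗ J = LinearMap.id) {a c : ℝ} (ha : 0 ≤ a) (hc : 0 ≤ c)
    (hA : ∀ i, realRank (FreeAlgebra.lift F A (P i)) ≤ a)
    (hAB : ∀ j, realRank (A j - J ∘ₗ B j ∘ₗ K) ≤ c) (hB : ∀ i, FreeAlgebra.lift F B (P i) = 0) :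
    ∃ (W' : Type) (_ : AddCommGroup W') (_ : Module F W') (_ : FiniteDimensional F W')
      (B' : σ → Module.End F W'), (∀ i, FreeAlgebra.lift F B' (P i) = 0) ∧
        IsNear (a + C * c + c) A B' := by
  have hKJ' : ∀ v, K (J v) = v := fun v => congr($hKJ v)
  set D : σ → Module.End F V := fun j => J ∘ₗ B j ∘ₗ K with hD
  have hCc : 0 ≤ C * c := by positivity
  by_cases hconst : ∀ i, FreeAlgebra.algebraMapInv (P i) = 0
  · refine ⟨V, inferInstance, inferInstance, inferInstance, D, fun i => ?_, LinearMap.id, ?_, ?_,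
      fun j => ?_⟩
    · rw [hD, FreeAlgebra.lift_extend_of_eq_zero hKJ (hB i), hconst, zero_smul]
    · rw [ker_id, finrank_bot, Nat.cast_zero]
      positivity
    · rw [sub_self, abs_zero]
      positivity
    · rw [id_comp, comp_id]
      linarith [hAB j]
  · push Not at hconst
    obtain ⟨i, hi⟩ := hconst
    have h1 : realRank (FreeAlgebra.lift F D (P i)) ≤ a + C * c := by
      have h2 := hlip V V A D LinearMap.id c hc (fun j => by simpa using hAB j) i
      rw [id_comp, comp_id] at h2
      have h3 : FreeAlgebra.lift F D (P i) = FreeAlgebra.lift F A (P i) -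
        (FreeAlgebra.lift F A (P i) - FreeAlgebra.lift F D (P i)) := by abel
      rw [h3]
      linarith [realRank_sub_le (FreeAlgebra.lift F A (P i))
        (FreeAlgebra.lift F A (P i) - FreeAlgebra.lift F D (P i)), hA i]
    have h2 : (LinearMap.id - J ∘ₗ K : V →ₗ[F] V) = FreeAlgebra.lift F D (P i) ∘ₗ
        ((FreeAlgebra.algebraMapInv (P i))⁻¹ • LinearMap.id) := by
      rw [hD, FreeAlgebra.lift_extend_of_eq_zero hKJ (hB i), comp_smul, comp_id, smul_smul,
        inv_mul_cancel₀ hi, one_smul]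
    have h3 : (Module.finrank F V : ℝ) - Module.finrank F W ≤ a + C * c := by
      have h4 := realRank_add_le (LinearMap.id - J ∘ₗ K : V →ₗ[F] V) (J ∘ₗ K)
      rw [sub_add_cancel, realRank_id] at h4
      have h5 := (realRank_comp_le_left J K).trans (realRank_le_finrank J)
      have h6 := realRank_comp_le_left (FreeAlgebra.lift F D (P i))
        ((FreeAlgebra.algebraMapInv (P i))⁻¹ • LinearMap.id)
      rw [← h2] at h6
      linarith
    have h4 := realRank_comp_le_left K J
    rw [hKJ, realRank_id] at h4
    have h5 := realRank_add_finrank_ker K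
    refine ⟨W, inferInstance, inferInstance, inferInstance, B, hB, K, ?_, ?_, fun j => ?_⟩
    · linarith
    · rw [abs_le]
      have h6 : (0 : ℝ) ≤ Module.finrank F (ker K) := Nat.cast_nonneg _
      have h7 := realRank_le_finrank_codomain K
      constructor <;> linarith
    · have h6 : K ∘ₗ A j - B j ∘ₗ K = K ∘ₗ (A j - J ∘ₗ B j ∘ₗ K) := by
        ext v
        simp [hKJ']
      rw [h6]
      linarith [realRank_comp_le_right K (A j - J ∘ₗ B j ∘ₗ K), hAB j]

theorem IsNear.mono {c c' : ℝ} {A : σ → Module.End F V} {B : σ → Module.End F W}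
    (h : IsNear c A B) (hc : c ≤ c') : IsNear c' A B := by
  obtain ⟨φ, h1, h2, h3⟩ := h
  exact ⟨φ, h1.trans hc, h2.trans hc, fun j => (h3 j).trans hc⟩

theorem IsNear.of_conj {c : ℝ} {U : Type} [AddCommGroup U] [Module F U] [FiniteDimensional F U]
    {A : σ → Module.End F U} {B : σ → Module.End F W} (e : U ≃ₗ[F] V)
    (h : IsNear c (fun j => (e.toLinearMap ∘ₗ A j ∘ₗ e.symm.toLinearMap : Module.End F V)) B) :
    IsNear c A B := by
  obtain ⟨φ, h1, h2, h3⟩ := h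
  refine ⟨φ ∘ₗ e.toLinearMap, ?_, ?_, fun j => ?_⟩
  · have h4 := finrank_ker_comp_le φ e.toLinearMap
    rw [LinearEquiv.ker, finrank_bot, Nat.cast_zero] at h4
    linarith
  · rwa [e.finrank_eq]
  · have : (φ ∘ₗ e.toLinearMap) ∘ₗ A j - B j ∘ₗ φ ∘ₗ e.toLinearMap =
        (φ ∘ₗ (e.toLinearMap ∘ₗ A j ∘ₗ e.symm.toLinearMap) - B j ∘ₗ φ) ∘ₗ e.toLinearMap := by
      ext v
      simp
    rw [this]
    exact (realRank_comp_le_left _ _).trans (h3 j)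

end Representations

section Padding

variable {F σ κ : Type} [Field F]

/-- The rectangular matrix with ones on the main diagonal and zeros elsewhere. -/
def rectOne (F : Type) [Field F] (m n : ℕ) : Matrix (Fin m) (Fin n) F :=
  Matrix.of fun i j => if (i : ℕ) = j then 1 else 0

theorem sum_rectOne_mul {m n : ℕ} (i : Fin m) (v : Fin n → F) :
    ∑ j, rectOne F m n i j * v j = if h : (i : ℕ) < n then v ⟨i, h⟩ else 0 := by
  split_ifs with h
  · rw [Finset.sum_eq_single ⟨i, h⟩]
    · simp [rectOne]
    · intro j _ hj
      have : (i : ℕ) ≠ j := fun hij => hj (Fin.ext hij.symm)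
      simp [rectOne, this]
    · simp
  · refine Finset.sum_eq_zero fun j _ => ?_
    have : (i : ℕ) ≠ j := fun hij => h (hij ▸ j.2)
    simp [rectOne, this]

theorem sum_mul_rectOne {m n : ℕ} (i : Fin m) (v : Fin n → F) :
    ∑ j, v j * rectOne F n m j i = if h : (i : ℕ) < n then v ⟨i, h⟩ else 0 := by
  rw [← sum_rectOne_mul]
  refine Finset.sum_congr rfl fun j _ => ?_
  simp [rectOne, eq_comm]

theorem padTo_eq_rectOne_mul {n : ℕ} (m : ℕ) (A : Matrix (Fin n) (Fin n) F) :
    padTo m A = rectOne F m n * A * rectOne F n m := by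
  ext i j
  simp only [Matrix.mul_apply, padTo, Matrix.of_apply]
  rw [sum_mul_rectOne]
  by_cases hj : (j : ℕ) < n
  · rw [dif_pos hj, sum_rectOne_mul]
    by_cases hi : (i : ℕ) < n <;> simp [hi, hj]
  · simp [hj]

theorem rectOne_mul_rectOne {m n : ℕ} (h : n ≤ m) : rectOne F n m * rectOne F m n = 1 := by
  ext i j
  rw [Matrix.mul_apply, sum_rectOne_mul, dif_pos (i.2.trans_le h)]
  simp [rectOne, Matrix.one_apply, Fin.ext_iff]

theorem padTo_self {n : ℕ} (A : Matrix (Fin n) (Fin n) F) : padTo n A = A := by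
  ext i j
  simp [padTo]

theorem cast_rank_eq_realRank {m n : ℕ} (A : Matrix (Fin m) (Fin n) F) :
    (A.rank : ℝ) = realRank (Matrix.toLin' A) := by
  rw [Matrix.rank, realRank, Matrix.toLin'_apply']

theorem toLin'_evalPoly {n : ℕ} (p : FreeAlgebra F σ) (A : σ → Matrix (Fin n) (Fin n) F) :
    Matrix.toLin' (evalPoly p A) = FreeAlgebra.lift F (fun j => Matrix.toLin' (A j)) p := by
  have : (Matrix.toLinAlgEquiv' : Matrix (Fin n) (Fin n) F ≃ₐ[F] _).toAlgHom.comp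
      (FreeAlgebra.lift F A) = FreeAlgebra.lift F (fun j => Matrix.toLin' (A j)) := by
    ext j
    simp
  exact congr($this p)

/-- The coordinate map `F ^ n → F ^ m` that truncates or extends by zero. -/
def rectId (F : Type) [Field F] (m n : ℕ) : (Fin n → F) →ₗ[F] (Fin m → F) :=
  Matrix.toLin' (rectOne F m n)

theorem rectId_comp_rectId {m n : ℕ} (h : n ≤ m) :
    rectId F n m ∘ₗ rectId F m n = LinearMap.id := by
  rw [rectId, rectId, ← Matrix.toLin'_mul, rectOne_mul_rectOne h, Matrix.toLin'_one]

theorem toLin'_padTo {n : ℕ} (m : ℕ) (A : Matrix (Fin n) (Fin n) F) :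
    Matrix.toLin' (padTo m A) = rectId F m n ∘ₗ Matrix.toLin' A ∘ₗ rectId F n m := by
  rw [padTo_eq_rectOne_mul, Matrix.toLin'_mul, Matrix.toLin'_mul, comp_assoc, rectId, rectId]

theorem padRankDiff_of_le {n n' : ℕ} (h : n ≤ n') (A : Matrix (Fin n) (Fin n) F)
    (B : Matrix (Fin n') (Fin n') F) :
    (padRankDiff A B : ℝ) =
      realRank (rectId F n' n ∘ₗ Matrix.toLin' A ∘ₗ rectId F n n' - Matrix.toLin' B) := by
  rw [padRankDiff, max_eq_right h, padTo_self, cast_rank_eq_realRank, map_sub, toLin'_padTo]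

theorem padRankDiff_of_ge {n n' : ℕ} (h : n' ≤ n) (A : Matrix (Fin n) (Fin n) F)
    (B : Matrix (Fin n') (Fin n') F) :
    (padRankDiff A B : ℝ) =
      realRank (Matrix.toLin' A - rectId F n n' ∘ₗ Matrix.toLin' B ∘ₗ rectId F n' n) := by
  rw [padRankDiff, max_eq_left h, padTo_self, cast_rank_eq_realRank, map_sub, toLin'_padTo]

theorem finrank_ker_rectId_of_le {m n : ℕ} (h : n ≤ m) :
    Module.finrank F (ker (rectId F m n)) = 0 := by
  have : ker (rectId F m n) = ⊥ := by
    rw [ker_eq_bot']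
    intro v hv
    have := congr($(rectId_comp_rectId (F := F) h) v)
    rwa [LinearMap.comp_apply, hv, map_zero, id_apply, eq_comm] at this
  rw [this, finrank_bot]

theorem finrank_ker_rectId_of_ge {m n : ℕ} (h : m ≤ n) :
    (Module.finrank F (ker (rectId F m n)) : ℝ) = n - m := by
  have h1 := realRank_add_finrank_ker (rectId F m n)
  have h2 := realRank_le_finrank_codomain (rectId F m n)
  have h3 := realRank_comp_le_left (rectId F m n) (rectId F n m)
  rw [rectId_comp_rectId h, realRank_id] at h3
  simp only [Module.finrank_fin_fun] at h1 h2 h3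
  linarith

theorem realRank_id_sub_rectId_le {m n : ℕ} (h : n ≤ m) :
    realRank (LinearMap.id - rectId F m n ∘ₗ rectId F n m) ≤ m - n := by
  have h1 := realRank_le_of_le_ker (S := range (rectId F m n))
    (g := LinearMap.id - rectId F m n ∘ₗ rectId F n m) (by
      rintro _ ⟨v, rfl⟩
      have := congr($(rectId_comp_rectId (F := F) h) v)
      rw [LinearMap.comp_apply, id_apply] at this
      simp [this])
  have h2 := realRank_add_finrank_ker (rectId F m n)
  rw [finrank_ker_rectId_of_le h] at h2
  unfold realRank at h1 h2 ⊢
  simp only [Module.finrank_fin_fun, Nat.cast_zero] at h1 h2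
  linarith

/-- Nearby tuples of endomorphisms become close in the padded rank distance in suitable bases. -/
theorem IsNear.exists_padRankDiff_le {n : ℕ} {c : ℝ} {W : Type} [AddCommGroup W] [Module F W]
    [FiniteDimensional F W] {A : σ → Matrix (Fin n) (Fin n) F} {B : σ → Module.End F W}
    (h : IsNear c (fun j => Matrix.toLin' (A j)) B) :
    ∃ e : W ≃ₗ[F] (Fin (Module.finrank F W) → F), ∀ j,
      (padRankDiff (A j) (LinearMap.toMatrix' (e.toLinearMap ∘ₗ B j ∘ₗ e.symm.toLinearMap)) : ℝ) ≤
        6 * c := by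
  obtain ⟨φ, hker, hdim, hφ⟩ := h
  set n' := Module.finrank F W with hn'
  rw [Module.finrank_fin_fun, abs_le] at hdim
  obtain ⟨e, he⟩ := exists_linearEquiv_realRank_le φ (rectId F n' n)
    (by rw [Module.finrank_fin_fun])
  have hkJ : (Module.finrank F (ker (rectId F n' n)) : ℝ) ≤ c := by
    rcases le_total n n' with hle | hle
    · rw [finrank_ker_rectId_of_le hle, Nat.cast_zero]
      exact (Nat.cast_nonneg _).trans hker
    · rw [finrank_ker_rectId_of_ge hle]
      linarith
  refine ⟨e, fun j => ?_⟩
  set A' := Matrix.toLin' (A j)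
  set B' : Module.End F (Fin n' → F) := e.toLinearMap ∘ₗ B j ∘ₗ e.symm.toLinearMap with hB'
  have key : realRank (rectId F n' n ∘ₗ A' - B' ∘ₗ rectId F n' n) ≤ 5 * c := by
    have h1 : rectId F n' n ∘ₗ A' - B' ∘ₗ rectId F n' n =
        (B' ∘ₗ (e.toLinearMap ∘ₗ φ - rectId F n' n) + e.toLinearMap ∘ₗ (φ ∘ₗ A' - B j ∘ₗ φ)) -
          (e.toLinearMap ∘ₗ φ - rectId F n' n) ∘ₗ A' := by
      apply LinearMap.ext
      intro v
      simp [hB']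
    rw [h1]
    have h2 := realRank_sub_le
      (B' ∘ₗ (e.toLinearMap ∘ₗ φ - rectId F n' n) + e.toLinearMap ∘ₗ (φ ∘ₗ A' - B j ∘ₗ φ))
      ((e.toLinearMap ∘ₗ φ - rectId F n' n) ∘ₗ A')
    have h3 := realRank_add_le
      (B' ∘ₗ (e.toLinearMap ∘ₗ φ - rectId F n' n)) (e.toLinearMap ∘ₗ (φ ∘ₗ A' - B j ∘ₗ φ))
    have h4 := realRank_comp_le_right B' (e.toLinearMap ∘ₗ φ - rectId F n' n)
    have h5 := realRank_comp_le_right e.toLinearMap (φ ∘ₗ A' - B j ∘ₗ φ)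
    have h6 := realRank_comp_le_left (e.toLinearMap ∘ₗ φ - rectId F n' n) A'
    linarith [hφ j]
  rcases le_total n n' with hle | hle
  · rw [padRankDiff_of_le hle, Matrix.toLin'_toMatrix']
    have h1 : rectId F n' n ∘ₗ A' ∘ₗ rectId F n n' - B' =
        (rectId F n' n ∘ₗ A' - B' ∘ₗ rectId F n' n) ∘ₗ rectId F n n' -
          B' ∘ₗ (LinearMap.id - rectId F n' n ∘ₗ rectId F n n') := by
      apply LinearMap.ext
      intro v
      simp
    rw [h1]
    have h2 := realRank_sub_le ((rectId F n' n ∘ₗ A' - B' ∘ₗ rectId F n' n) ∘ₗ rectId F n n')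
      (B' ∘ₗ (LinearMap.id - rectId F n' n ∘ₗ rectId F n n'))
    have h3 := realRank_comp_le_left (rectId F n' n ∘ₗ A' - B' ∘ₗ rectId F n' n) (rectId F n n')
    have h4 := realRank_comp_le_right B' (LinearMap.id - rectId F n' n ∘ₗ rectId F n n')
    have h5 := realRank_id_sub_rectId_le (F := F) hle
    linarith
  · rw [padRankDiff_of_ge hle, Matrix.toLin'_toMatrix']
    have h1 : A' - rectId F n n' ∘ₗ B' ∘ₗ rectId F n' n =
        rectId F n n' ∘ₗ (rectId F n' n ∘ₗ A' - B' ∘ₗ rectId F n' n) +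
          (LinearMap.id - rectId F n n' ∘ₗ rectId F n' n) ∘ₗ A' := by
      apply LinearMap.ext
      intro v
      simp
    rw [h1]
    have h2 := realRank_add_le (rectId F n n' ∘ₗ (rectId F n' n ∘ₗ A' - B' ∘ₗ rectId F n' n))
      ((LinearMap.id - rectId F n n' ∘ₗ rectId F n' n) ∘ₗ A')
    have h3 := realRank_comp_le_right (rectId F n n') (rectId F n' n ∘ₗ A' - B' ∘ₗ rectId F n' n)
    have h4 := realRank_comp_le_left (LinearMap.id - rectId F n n' ∘ₗ rectId F n' n) A'
    have h5 := realRank_id_sub_rectId_le (F := F) hle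
    linarith

theorem LinearRankStable.rankStable {P : κ → FreeAlgebra F σ} (h : LinearRankStable P) :
    RankStable F P := by
  intro ε hε
  obtain ⟨δ, hδ, hst⟩ := h (min (ε / 7) (1 / 2)) (by positivity)
  refine ⟨δ, hδ, fun n hn A hA => ?_⟩
  have hn' : (0 : ℝ) < n := by exact_mod_cast hn
  obtain ⟨W, _, _, _, B, hB, hAB⟩ := hst (Fin n → F) (fun j => Matrix.toLin' (A j)) n
    (by rw [Module.finrank_fin_fun]) (fun i => by
      rw [← toLin'_evalPoly, ← cast_rank_eq_realRank]
      exact (hA i).le)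
  have hc₁ : min (ε / 7) (1 / 2) * n ≤ ε / 7 * n := by gcongr; exact min_le_left _ _
  have hc₂ : min (ε / 7) (1 / 2) * n ≤ 1 / 2 * n := by gcongr; exact min_le_right _ _
  obtain ⟨e, he⟩ := hAB.exists_padRankDiff_le
  obtain ⟨-, -, hdim, -⟩ := hAB
  rw [Module.finrank_fin_fun, abs_le] at hdim
  refine ⟨Module.finrank F W, ?_,
    fun j => LinearMap.toMatrix' (e.toLinearMap ∘ₗ B j ∘ₗ e.symm.toLinearMap), fun i => ?_,
    fun j => (he j).trans_lt ?_⟩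
  · have : (0 : ℝ) < Module.finrank F W := by linarith
    exact_mod_cast this
  · apply Matrix.toLin'.injective
    rw [toLin'_evalPoly, map_zero]
    simp only [Matrix.toLin'_toMatrix']
    have h1 := FreeAlgebra.comp_lift_eq_lift_comp (A := B)
      (B := fun j => (e.toLinearMap ∘ₗ B j ∘ₗ e.symm.toLinearMap : Module.End F _))
      (φ := e.toLinearMap) (fun j => by ext v; simp) (P i)
    rw [hB, comp_zero] at h1
    apply LinearMap.ext
    intro v
    simpa using congr($h1.symm (e.symm v))
  · nlinarith

theorem RankStable.linearRankStable [Fintype σ] [Finite κ] {P : κ → FreeAlgebra F σ}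
    (h : RankStable F P) : LinearRankStable P := by
  intro ε hε
  obtain ⟨C, hC, hlip⟩ := FreeAlgebra.exists_forall_realRank_intertwine_le P
  set q : ℝ := ε / (2 * (C + Fintype.card σ + 2)) with hq
  have hq0 : 0 < q := by positivity
  have hqε : 2 * (q * C + q * Fintype.card σ + q * 2) = ε := by
    rw [hq]
    field_simp
  obtain ⟨δ, hδ, hst⟩ := h q hq0
  refine ⟨min (δ * ε) (ε / 2), by positivity, fun V _ _ _ A N hN hA => ?_⟩
  have hN0 : 0 ≤ N := (Nat.cast_nonneg _).trans hN
  have hδ₁ : min (δ * ε) (ε / 2) * N ≤ δ * (ε * N) := by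
    rw [← mul_assoc]
    gcongr
    exact min_le_left _ _
  have hδ₂ : min (δ * ε) (ε / 2) * N ≤ ε / 2 * N := by gcongr; exact min_le_right _ _
  by_cases hsmall : (Module.finrank F V : ℝ) ≤ ε * N
  · refine ⟨PUnit, inferInstance, inferInstance, inferInstance, 0, fun i => ?_, 0, ?_, ?_,
      fun j => ?_⟩
    · exact LinearMap.ext fun v => Subsingleton.elim _ _
    · rw [ker_zero, finrank_top]
      exact hsmall
    · rw [Module.finrank_zero_of_subsingleton (M := PUnit), Nat.cast_zero, sub_zero, Nat.abs_cast]
      exact hsmall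
    · rw [zero_comp, comp_zero, sub_zero, realRank_zero]
      positivity
  · push Not at hsmall
    set n := Module.finrank F V with hn
    have hn0 : (0 : ℝ) < n := lt_of_le_of_lt (by positivity) hsmall
    let e : V ≃ₗ[F] (Fin n → F) := LinearEquiv.ofFinrankEq _ _ (by simp [hn])
    set A' : σ → Module.End F (Fin n → F) :=
      fun j => e.toLinearMap ∘ₗ A j ∘ₗ e.symm.toLinearMap with hA'
    have hA'N : ∀ i, realRank (FreeAlgebra.lift F A' (P i)) ≤ min (δ * ε) (ε / 2) * N := fun i => by
      have h1 := FreeAlgebra.comp_lift_eq_lift_comp (A := A) (B := A') (φ := e.toLinearMap)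
        (fun j => by ext v; simp [hA']) (P i)
      have h2 : FreeAlgebra.lift F A' (P i) =
          e.toLinearMap ∘ₗ FreeAlgebra.lift F A (P i) ∘ₗ e.symm.toLinearMap := by
        rw [← comp_assoc, h1, comp_assoc, LinearEquiv.comp_symm, comp_id]
      rw [h2]
      exact ((realRank_comp_le_right _ _).trans (realRank_comp_le_left _ _)).trans (hA i)
    obtain ⟨n', -, B, hB, hAB⟩ := hst n (by exact_mod_cast hn0)
      (fun j => LinearMap.toMatrix' (A' j)) (fun i => by
        rw [cast_rank_eq_realRank, toLin'_evalPoly]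
        simp only [Matrix.toLin'_toMatrix']
        have : δ * (ε * N) < δ * n := by gcongr
        linarith [hA'N i])
    have hB' : ∀ i, FreeAlgebra.lift F (fun j => Matrix.toLin' (B j)) (P i) = 0 := fun i => by
      rw [← toLin'_evalPoly, hB, map_zero]
    have hqn : q * n ≤ q * N := by gcongr
    have hqNε : 2 * (q * C * N + q * Fintype.card σ * N + q * N * 2) = ε * N := by
      rw [← hqε]
      ring
    have hqCN : q * C * n ≤ q * C * N := by gcongr
    have hqσN : q * Fintype.card σ * n ≤ q * Fintype.card σ * N := by gcongr
    have hqCN0 : 0 ≤ q * C * N := by positivity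
    have hqσN0 : 0 ≤ q * Fintype.card σ * N := by positivity
    have hqN0 : 0 ≤ q * N := by positivity
    rcases le_total n n' with hle | hle
    · obtain ⟨W, i1, i2, i3, B', hPB', hnear⟩ := exists_isNear_of_expansion (A := A')
        (B := fun j => Matrix.toLin' (B j)) (rectId_comp_rectId (F := F) hle)
        (c := q * n) (by positivity) (fun j => by
          have := hAB j
          rw [padRankDiff_of_le hle, Matrix.toLin'_toMatrix'] at this
          exact this.le) hB'
      refine ⟨W, i1, i2, i3, B', hPB', (hnear.mono ?_).of_conj e⟩
      linarith
    · obtain ⟨W, i1, i2, i3, B', hPB', hnear⟩ := exists_isNear_of_contraction hC hlip (A := A')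
        (B := fun j => Matrix.toLin' (B j)) (rectId_comp_rectId (F := F) hle)
        (a := min (δ * ε) (ε / 2) * N) (c := q * n) (by positivity) (by positivity) hA'N (fun j => by
          have := hAB j
          rw [padRankDiff_of_ge hle, Matrix.toLin'_toMatrix'] at this
          exact this.le) hB'
      refine ⟨W, i1, i2, i3, B', hPB', (hnear.mono ?_).of_conj e⟩
      linarith

end Padding

/-- **Direct products preserve rank-stability.** Suppose the systems `P` and `Q` each admit
an exact solution by matrices of some positive size. Then the presentation of the direct
product of the two presented algebras is rank-stable if and only if both presentations are
rank-stable. -/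
theorem stmt4_direct_product_rank_stable_iff
    (F : Type) [Field F] (d t r s : ℕ)
    (P : Fin r → FreeAlgebra F (Fin d)) (Q : Fin s → FreeAlgebra F (Fin t))
    (hPrep : ∃ n : ℕ, 0 < n ∧ ∃ A : Fin d → Matrix (Fin n) (Fin n) F,
      ∀ i, evalPoly (P i) A = 0)
    (hQrep : ∃ n : ℕ, 0 < n ∧ ∃ B : Fin t → Matrix (Fin n) (Fin n) F,
      ∀ j, evalPoly (Q j) B = 0) :
    RankStable F (directProductRels F P Q) ↔ (RankStable F P ∧ RankStable F Q) := by
  exact ⟨fun h => ⟨h.linearRankStable.left_of_directProduct.rankStable,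
      h.linearRankStable.directProduct_swap.left_of_directProduct.rankStable⟩,
    fun h => (h.1.linearRankStable.directProduct h.2.linearRankStable).rankStable⟩
end
end

section
/- The projectivization of the first Weyl algebra, presented as ℂ⟨x,y,t⟩/⟨xt − tx, yt − ty, xy − yx − t²⟩, is not rank-stable; moreover, the algebra it presents is residually finite-dimensional, i.e., for every nonzero element a of the quotient algebra there exist n ≥ 1 and a ℂ-algebra homomorphism f into M_n(ℂ) with f(a) ≠ 0. -/
open Matrix

noncomputable section

/-- The defining relations `xt − tx`, `yt − ty`, `xy − yx − t²` of the projectivization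
`ℂ⟨x,y,t⟩/⟨xt − tx, yt − ty, xy − yx − t²⟩` of the first Weyl algebra
(generators: `0 = x`, `1 = y`, `2 = t`). -/
def projWeylRels : Fin 3 → FreeAlgebra ℂ (Fin 3) :=
  ![FreeAlgebra.ι ℂ 0 * FreeAlgebra.ι ℂ 2 - FreeAlgebra.ι ℂ 2 * FreeAlgebra.ι ℂ 0,
    FreeAlgebra.ι ℂ 1 * FreeAlgebra.ι ℂ 2 - FreeAlgebra.ι ℂ 2 * FreeAlgebra.ι ℂ 1,
    FreeAlgebra.ι ℂ 0 * FreeAlgebra.ι ℂ 1 - FreeAlgebra.ι ℂ 1 * FreeAlgebra.ι ℂ 0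
      - FreeAlgebra.ι ℂ 2 * FreeAlgebra.ι ℂ 2]

/-- In a finite-dimensional representation of `xy - yx = t²` with `t` central, `1` is not an
eigenvalue of `t`: the trace of `t²` on the eigenspace would be both zero and its dimension. -/
lemma ker_sub_one_eq_bot_of_commutator_eq_sq {K V : Type*} [Field K] [CharZero K]
    [AddCommGroup V] [Module K V] [FiniteDimensional K V] {x y t : Module.End K V}
    (hx : x * t = t * x) (hy : y * t = t * y) (hxy : x * y - y * x = t * t) :
    LinearMap.ker (t - 1) = ⊥ := by
  have ht : ∀ v ∈ LinearMap.ker (t - 1), t v = v := fun v hv => by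
    simpa [sub_eq_zero] using hv
  have invariant : ∀ z : Module.End K V, z * t = t * z →
      ∀ v ∈ LinearMap.ker (t - 1), z v ∈ LinearMap.ker (t - 1) := fun z hz v hv => by
    have h := LinearMap.congr_fun hz v
    simp only [Module.End.mul_apply, ht v hv] at h
    simp [← h]
  let x' := x.restrict (invariant x hx)
  let y' := y.restrict (invariant y hy)
  have h1 : x' * y' - y' * x' = 1 := by
    ext v
    have h := LinearMap.congr_fun hxy v
    simpa [x', y', ht v v.2] using h
  have h2 := congrArg (LinearMap.trace K _) h1
  rw [map_sub, LinearMap.trace_mul_comm, sub_self, LinearMap.trace_one] at h2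
  exact Submodule.finrank_eq_zero.mp (by exact_mod_cast h2.symm)

lemma eq_zero_of_mulVec_eq_self {n : ℕ} {B : Fin 3 → Matrix (Fin n) (Fin n) ℂ}
    (hB : ∀ i, evalPoly (projWeylRels i) B = 0) {u : Fin n → ℂ} (hu : B 2 *ᵥ u = u) :
    u = 0 := by
  have h0 := hB 0
  have h1 := hB 1
  have h2 := hB 2
  simp only [evalPoly, projWeylRels, Matrix.cons_val, map_sub, map_mul,
    FreeAlgebra.lift_ι_apply, sub_eq_zero] at h0 h1 h2
  have key := ker_sub_one_eq_bot_of_commutator_eq_sq (K := ℂ)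
    (x := Matrix.toLinAlgEquiv' (B 0)) (y := Matrix.toLinAlgEquiv' (B 1))
    (t := Matrix.toLinAlgEquiv' (B 2)) (by simp only [← map_mul, h0])
    (by simp only [← map_mul, h1]) (by simp only [← map_mul, ← map_sub, h2])
  have hmem : u ∈ LinearMap.ker (Matrix.toLinAlgEquiv' (B 2) - 1) := by
    simp [hu]
  simpa [key] using hmem

/-- The inclusion of the first `n` coordinates into `m` coordinates. -/
def inclMatrix (n m : ℕ) : Matrix (Fin m) (Fin n) ℂ :=
  Matrix.of fun i j => if (i : ℕ) = j then 1 else 0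

lemma inclMatrix_transpose_mul_self {n m : ℕ} (h : n ≤ m) :
    (inclMatrix n m)ᵀ * inclMatrix n m = 1 := by
  ext i j
  rw [Matrix.mul_apply, Finset.sum_eq_single (Fin.castLE h i)]
  · simp [inclMatrix, Matrix.one_apply, Fin.ext_iff]
  · intro k _ hk
    simp only [inclMatrix, Matrix.transpose_apply, Matrix.of_apply]
    have hki : (k : ℕ) ≠ i := fun h' => hk (Fin.ext h')
    rw [if_neg hki, zero_mul]
  · simp

lemma padTo_eq_mul_mul_transpose {n : ℕ} (m : ℕ) (A : Matrix (Fin n) (Fin n) ℂ) :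
    padTo m A = inclMatrix n m * A * (inclMatrix n m)ᵀ := by
  have left : ∀ (i : Fin m) (j : Fin n), (inclMatrix n m * A) i j =
      if h : (i : ℕ) < n then A ⟨i, h⟩ j else 0 := fun i j => by
    rw [Matrix.mul_apply]
    split_ifs with h
    · rw [Finset.sum_eq_single ⟨i, h⟩]
      · simp [inclMatrix]
      · intro k _ hk
        simp only [inclMatrix, Matrix.of_apply]
        rw [if_neg (fun h' => hk (Fin.ext h'.symm)), zero_mul]
      · simp
    · refine Finset.sum_eq_zero fun k _ => ?_
      simp only [inclMatrix, Matrix.of_apply]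
      rw [if_neg (by omega), zero_mul]
  ext i j
  rw [Matrix.mul_apply]
  simp only [left, padTo, Matrix.transpose_apply]
  simp only [inclMatrix, Matrix.of_apply]
  by_cases hj : (j : ℕ) < n
  · rw [Finset.sum_eq_single ⟨j, hj⟩]
    · simp [hj]
    · intro k _ hk
      rw [if_neg (fun h' => hk (Fin.ext h'.symm)), mul_zero]
    · simp
  · rw [dif_neg (fun h => hj h.2), eq_comm]
    refine Finset.sum_eq_zero fun k _ => ?_
    rw [if_neg (by omega), mul_zero]

/-- A matrix without eigenvalue `1` has maximal rank distance from the identity. -/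
lemma le_padRankDiff_one {n n' : ℕ} {N : Matrix (Fin n') (Fin n') ℂ}
    (hN : ∀ u, N *ᵥ u = u → u = 0) :
    n ≤ padRankDiff (1 : Matrix (Fin n) (Fin n) ℂ) N := by
  unfold padRankDiff
  rw [padTo_eq_mul_mul_transpose, padTo_eq_mul_mul_transpose, Matrix.mul_one]
  set E := inclMatrix n (max n n')
  set G := inclMatrix n' (max n n')
  have hE : Eᵀ * E = 1 := inclMatrix_transpose_mul_self (le_max_left _ _)
  have hG : Gᵀ * G = 1 := inclMatrix_transpose_mul_self (le_max_right _ _)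
  refine le_trans ?_ (Matrix.rank_mul_le_left _ E)
  have hmul : (E * Eᵀ - G * N * Gᵀ) * E = E - G * N * (Gᵀ * E) := by
    rw [Matrix.sub_mul, Matrix.mul_assoc E, hE, Matrix.mul_one, Matrix.mul_assoc (G * N)]
  rw [hmul, Matrix.rank, LinearMap.finrank_range_of_inj, Module.finrank_fin_fun]
  rw [← LinearMap.ker_eq_bot, LinearMap.ker_eq_bot']
  intro v hv
  rw [Matrix.mulVecLin_apply, Matrix.sub_mulVec, sub_eq_zero] at hv
  have hfix : N *ᵥ ((Gᵀ * E) *ᵥ v) = (Gᵀ * E) *ᵥ v := by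
    conv_rhs => rw [← Matrix.mulVec_mulVec, hv, Matrix.mulVec_mulVec]
    rw [Matrix.mulVec_mulVec, ← Matrix.mul_assoc Gᵀ, ← Matrix.mul_assoc Gᵀ, hG, Matrix.one_mul]
  rw [← Matrix.mulVec_mulVec, hN _ hfix, Matrix.mulVec_zero] at hv
  rw [← Matrix.one_mulVec v, ← hE, ← Matrix.mulVec_mulVec, hv, Matrix.mulVec_zero]

/-- Differentiation on the polynomials of degree at most `m`, in the monomial basis. -/
def derivMatrix (m : ℕ) : Matrix (Fin (m + 1)) (Fin (m + 1)) ℂ :=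
  Matrix.of fun i j => if (j : ℕ) = i + 1 then (j : ℂ) else 0

/-- Truncated multiplication by the variable on the polynomials of degree at most `m`. -/
def shiftMatrix (m : ℕ) : Matrix (Fin (m + 1)) (Fin (m + 1)) ℂ :=
  Matrix.of fun i j => if (i : ℕ) = j + 1 then 1 else 0

lemma derivMatrix_mul_shiftMatrix (m : ℕ) : derivMatrix m * shiftMatrix m =
    Matrix.diagonal fun i : Fin (m + 1) => if (i : ℕ) < m then (i : ℂ) + 1 else 0 := by
  ext i k
  rw [Matrix.mul_apply, Matrix.diagonal_apply]
  simp only [derivMatrix, shiftMatrix, Matrix.of_apply]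
  by_cases hi : (i : ℕ) < m
  · rw [Finset.sum_eq_single ⟨i + 1, by omega⟩]
    · simp [hi, Fin.ext_iff]
    · intro j _ hj
      rw [if_neg (fun h => hj (Fin.ext h)), zero_mul]
    · simp
  · rw [if_neg hi, ite_self]
    refine Finset.sum_eq_zero fun j _ => ?_
    rw [if_neg (by omega), zero_mul]

lemma shiftMatrix_mul_derivMatrix (m : ℕ) : shiftMatrix m * derivMatrix m =
    Matrix.diagonal fun i : Fin (m + 1) => ((i : ℕ) : ℂ) := by
  ext i k
  rw [Matrix.mul_apply, Matrix.diagonal_apply]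
  simp only [derivMatrix, shiftMatrix, Matrix.of_apply]
  by_cases hi : (i : ℕ) = 0
  · rw [hi, Nat.cast_zero, ite_self]
    refine Finset.sum_eq_zero fun j _ => ?_
    rw [if_neg (by omega), zero_mul]
  · rw [Finset.sum_eq_single ⟨i - 1, by omega⟩]
    · have h : (i : ℕ) = i - 1 + 1 := by omega
      rw [if_pos h, one_mul]
      simp only [← h, Fin.ext_iff, eq_comm (a := (k : ℕ))]
      split_ifs with hk
      · rw [hk]
      · rfl
    · intro j _ hj
      have hji : (j : ℕ) ≠ i - 1 := fun h => hj (Fin.ext h)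
      rw [if_neg (by omega), zero_mul]
    · simp

lemma rank_commutator_sub_one_le (m : ℕ) :
    (derivMatrix m * shiftMatrix m - shiftMatrix m * derivMatrix m - 1).rank ≤ 1 := by
  have h : derivMatrix m * shiftMatrix m - shiftMatrix m * derivMatrix m - 1 =
      Matrix.vecMulVec (Pi.single (Fin.last m) 1) (Pi.single (Fin.last m) (-(m : ℂ) - 1)) := by
    rw [derivMatrix_mul_shiftMatrix, shiftMatrix_mul_derivMatrix, ← Matrix.diagonal_one,
      Matrix.diagonal_sub, Matrix.diagonal_sub]
    ext i j
    rw [Matrix.diagonal_apply, Matrix.vecMulVec_apply]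
    by_cases hl : i = Fin.last m
    · subst hl
      by_cases hj : Fin.last m = j
      · subst hj; simp
      · simp [hj, Ne.symm hj]
    · have : (i : ℕ) < m := Fin.val_lt_last hl
      simp [this, hl, Pi.single_apply]
  rw [h]
  exact Matrix.rank_vecMulVec_le _ _

theorem not_rankStable_projWeylRels : ¬ RankStable ℂ projWeylRels := by
  intro h
  obtain ⟨δ, hδ, hstable⟩ := h 1 one_pos
  obtain ⟨m, hm⟩ := exists_nat_gt (1 / δ)
  have hbig : 1 < δ * ((m + 1 : ℕ) : ℝ) := by
    rw [div_lt_iff₀ hδ] at hm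
    push_cast
    nlinarith
  obtain ⟨n', -, B, hB, hclose⟩ := hstable (m + 1) m.succ_pos
    ![derivMatrix m, shiftMatrix m, 1] (fun i => by
      refine lt_of_le_of_lt ?_ hbig
      fin_cases i
      · simp [evalPoly, projWeylRels]
      · simp [evalPoly, projWeylRels]
      · simpa [evalPoly, projWeylRels] using rank_commutator_sub_one_le m)
  have hlt := hclose 2
  rw [one_mul, Nat.cast_lt] at hlt
  exact absurd (le_padRankDiff_one fun u => eq_zero_of_mulVec_eq_self hB) (not_le.mpr hlt)

/-- A finite-dimensional module, in coordinates. -/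
lemma exists_matrix_rep_of_finite_module {F R V : Type*} [Field F] [Ring R] [Algebra F R]
    [AddCommGroup V] [Module F V] [Module R V] [IsScalarTower F R V] [Module.Finite F V]
    {a : R} {v : V} (ha : a • v ≠ 0) :
    ∃ n : ℕ, 0 < n ∧ ∃ f : R →ₐ[F] Matrix (Fin n) (Fin n) F,
      (∀ r, (∀ w : V, r • w = 0) → f r = 0) ∧ f a ≠ 0 := by
  have : Nontrivial V := ⟨_, _, ha⟩
  let e := algEquivMatrix (Module.finBasis F V)
  refine ⟨_, Module.finrank_pos (R := F) (M := V),
    e.toAlgHom.comp (Algebra.lsmul F F V), fun r hr => ?_, fun h => ?_⟩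
  · have h0 : Algebra.lsmul F F V r = 0 := LinearMap.ext hr
    simp [h0]
  · have h0 : Algebra.lsmul F F V a = 0 := e.injective (by simpa using h)
    exact ha (LinearMap.congr_fun h0 v)

section Homogenize

open Polynomial

variable {F σ A : Type*} [Field F] [Ring A] [Algebra F A] (q : FreeAlgebra F σ →ₐ[F] A)

/-- The homogenisation of `q`: each generator is sent to its image under `q` times the
grading variable. -/
def homogenize : FreeAlgebra F σ →ₐ[F] A[X] :=
  FreeAlgebra.lift F fun s => monomial 1 (q (FreeAlgebra.ι F s))

lemma homogenize_ι (s : σ) :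
    homogenize q (FreeAlgebra.ι F s) = monomial 1 (q (FreeAlgebra.ι F s)) :=
  FreeAlgebra.lift_ι_apply _ _

lemma eval_one_homogenize (b : FreeAlgebra F σ) : (homogenize q b).eval 1 = q b := by
  induction b using FreeAlgebra.induction with
  | grade0 r => simp [Polynomial.algebraMap_apply]
  | grade1 s => simp [homogenize_ι]
  | mul b c hb hc =>
    rw [map_mul, eval, eval₂_mul_noncomm _ _ fun _ => Commute.one_right _, map_mul, ← hb, ← hc]
    rfl
  | add b c hb hc => simp [hb, hc]

lemma coeff_homogenize_mem (b : FreeAlgebra F σ) (n : ℕ) : (homogenize q b).coeff n ∈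
    Submodule.span F (Set.range fun s => q (FreeAlgebra.ι F s)) ^ n := by
  induction b using FreeAlgebra.induction generalizing n with
  | grade0 r =>
    rw [AlgHom.commutes, Polynomial.algebraMap_apply, coeff_C]
    split_ifs with h
    · subst h
      rw [pow_zero]
      exact Submodule.algebraMap_mem r
    · exact zero_mem _
  | grade1 s =>
    rw [homogenize_ι, coeff_monomial]
    split_ifs with h
    · subst h
      rw [pow_one]
      exact Submodule.subset_span ⟨s, rfl⟩
    · exact zero_mem _
  | mul b c hb hc =>
    rw [map_mul, coeff_mul]
    refine Submodule.sum_mem _ fun p hp => ?_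
    rw [← Finset.HasAntidiagonal.mem_antidiagonal.mp hp, pow_add]
    exact Submodule.mul_mem_mul (hb _) (hc _)
  | add b c hb hc =>
    rw [map_add, coeff_add]
    exact add_mem (hb n) (hc n)

/-- The left ideal of elements whose homogenisation vanishes to order `M`. -/
def vanishingIdeal (M : ℕ) : Submodule (FreeAlgebra F σ) (FreeAlgebra F σ) where
  carrier := {b | ∀ n < M, (homogenize q b).coeff n = 0}
  add_mem' hb hc n hn := by rw [map_add, coeff_add, hb n hn, hc n hn, add_zero]
  zero_mem' n _ := by simp
  smul_mem' c b hb n hn := by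
    rw [smul_eq_mul, map_mul, coeff_mul]
    refine Finset.sum_eq_zero fun p hp => ?_
    rw [hb p.2 (by have := Finset.HasAntidiagonal.mem_antidiagonal.mp hp; omega), mul_zero]

lemma finite_quotient_vanishingIdeal [Finite σ] (M : ℕ) :
    Module.Finite F (FreeAlgebra F σ ⧸ vanishingIdeal q M) := by
  let V : Submodule F A := Submodule.span F (Set.range fun s => q (FreeAlgebra.ι F s))
  have hV : V.FG := Submodule.fg_span (Set.finite_range _)
  have (n : Fin M) : Module.Finite F (V ^ (n : ℕ) : Submodule F A) :=
    Module.Finite.iff_fg.mpr (hV.pow n)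
  let coeffs : FreeAlgebra F σ →ₗ[F] ((n : Fin M) → (V ^ (n : ℕ) : Submodule F A)) :=
    LinearMap.pi fun n => LinearMap.codRestrict _
      (((lcoeff A n).restrictScalars F).comp (homogenize q).toLinearMap)
      fun b => coeff_homogenize_mem q b n
  have hker : (vanishingIdeal q M).restrictScalars F = LinearMap.ker coeffs := by
    ext b
    rw [LinearMap.mem_ker, funext_iff]
    exact ⟨fun h n => Subtype.ext (h n n.2), fun h n hn => congrArg Subtype.val (h ⟨n, hn⟩)⟩
  have : Module.Finite F (FreeAlgebra F σ ⧸ LinearMap.ker coeffs) :=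
    Module.Finite.equiv coeffs.quotKerEquivRange.symm
  rw [← hker] at this
  exact Module.Finite.equiv (Submodule.Quotient.restrictScalarsEquiv F (vanishingIdeal q M))

lemma exists_notMem_vanishingIdeal {a : FreeAlgebra F σ} (ha : q a ≠ 0) :
    ∃ M, a ∉ vanishingIdeal q M := by
  refine ⟨(homogenize q a).natDegree + 1, fun h => ha ?_⟩
  have h0 : homogenize q a = 0 := by
    rw [← leadingCoeff_eq_zero]
    exact h _ (Nat.lt_succ_self _)
  rw [← eval_one_homogenize, h0, eval_zero]

end Homogenize

theorem exists_matrix_rep_of_notMem_span_projWeylRels {a : FreeAlgebra ℂ (Fin 3)}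
    (ha : a ∉ TwoSidedIdeal.span (Set.range projWeylRels)) :
    ∃ n : ℕ, 0 < n ∧ ∃ f : FreeAlgebra ℂ (Fin 3) →ₐ[ℂ] Matrix (Fin n) (Fin n) ℂ,
      (∀ i, f (projWeylRels i) = 0) ∧ f a ≠ 0 := by
  let I := TwoSidedIdeal.span (Set.range projWeylRels)
  let q : FreeAlgebra ℂ (Fin 3) →ₐ[ℂ] I.ringCon.Quotient :=
    { I.ringCon.mk' with commutes' := fun _ => rfl }
  have hq : ∀ b, q b = 0 ↔ b ∈ I := fun b => by
    rw [TwoSidedIdeal.mem_iff, ← RingCon.eq]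
    rfl
  obtain ⟨M, hM⟩ := exists_notMem_vanishingIdeal q fun h => ha ((hq a).mp h)
  have := finite_quotient_vanishingIdeal q M
  obtain ⟨n, hn, f, hf, hfa⟩ := exists_matrix_rep_of_finite_module (F := ℂ)
    (V := FreeAlgebra ℂ (Fin 3) ⧸ vanishingIdeal q M) (a := a) (v := Submodule.Quotient.mk 1)
    (by rwa [← Submodule.Quotient.mk_smul, smul_eq_mul, mul_one, Ne,
      Submodule.Quotient.mk_eq_zero])
  refine ⟨n, hn, f, fun i => hf _ fun w => ?_, hfa⟩
  obtain ⟨b, rfl⟩ := Submodule.Quotient.mk_surjective _ w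
  rw [← Submodule.Quotient.mk_smul, smul_eq_mul, Submodule.Quotient.mk_eq_zero]
  have hzero : homogenize q (projWeylRels i) = 0 := by
    have hi := (hq _).mpr (TwoSidedIdeal.subset_span (Set.mem_range_self i))
    fin_cases i <;>
      simp only [projWeylRels, Fin.mk_one, Fin.zero_eta, Fin.reduceFinMk, Matrix.cons_val,
        map_sub, map_mul, homogenize_ι, Polynomial.monomial_mul_monomial] at hi ⊢ <;>
      simp only [← map_sub, hi, map_zero]
  intro k _
  rw [map_mul, hzero, zero_mul, Polynomial.coeff_zero]

/-- **The projectivization of the first Weyl algebra** is not rank-stable, yet the algebra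
it presents is residually finite-dimensional: every element outside the ideal of relations
(i.e. every nonzero element of the quotient) is detected by a finite-dimensional
representation killing the relations. -/
theorem stmt8_projective_weyl_not_rank_stable_but_residually_finite_dimensional :
    ¬ RankStable ℂ projWeylRels ∧
    ∀ a : FreeAlgebra ℂ (Fin 3),
      a ∉ TwoSidedIdeal.span (Set.range projWeylRels) →
      ∃ n : ℕ, 0 < n ∧
        ∃ f : FreeAlgebra ℂ (Fin 3) →ₐ[ℂ] Matrix (Fin n) (Fin n) ℂ,
          (∀ i, f (projWeylRels i) = 0) ∧ f a ≠ 0 := by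
  exact ⟨not_rankStable_projWeylRels, fun _ => exists_matrix_rep_of_notMem_span_projWeylRels⟩
end
end
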